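/- Let n ≥ 1, let ω : (0,∞) → [0,∞) be non-decreasing and satisfy the log-Dini(1) condition, let K be a bilinear Calderón–Zygmund kernel of ω type with constant C₀ > 0 on ℝⁿ, and let T be a bilinear operator on pairs of integrable functions with kernel representation by K (as in the off-support integral formula). Let b₁, b₂ : ℝⁿ → ℝ be locally integrable with finite BMO seminorms, and define the commutator T_{b⃗}(f₁,f₂) = [b₁·T(f₁,f₂) − T(b₁f₁, f₂)] + [b₂·T(f₁,f₂) − T(f₁, b₂f₂)]. Assume there are C₁, C₂ > 0 such that λ·|{x : |T_{b⃗}(f,g)(x)| > λ}| ≤ C₁‖f‖_{L²}‖g‖_{L²} for all bounded compactly supported f, g and λ > 0, and |{x : |T(f,g)(x)| > λ}| ≤ (C₂‖f‖_{L¹}‖g‖_{L¹}/λ)^{1/2} for all f, g ∈ L¹(ℝⁿ), λ > 0. Then there is C, depending only on n, ω, ‖b₁‖_* and ‖b₂‖_*, such that for every λ > 0 and all f₁, f₂ that are finite sums of (1,∞,0)-atoms supported on dyadic cubes with coefficient ℓ¹-sums at most 1, |{x ∈ ℝⁿ : |T_{b⃗}(f₁,f₂)(x)| > λ}| ≤ C·(C₀+C₁+C₂)^{1/2}·λ^{−1/2}.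 -/

import Mathlib

open MeasureTheory Set
open scoped ENNReal

noncomputable section

/-- Euclidean space `ℝⁿ`. -/
abbrev Rn (n : ℕ) : Type := EuclideanSpace ℝ (Fin n)

/-- A dyadic cube `∏ [2^k mᵢ, 2^k (mᵢ+1))` in `ℝⁿ`. -/
def IsDyadicCube {n : ℕ} (Q : Set (Rn n)) : Prop :=
  ∃ (k : ℤ) (m : Fin n → ℤ),
    Q = {x : Rn n | ∀ i, (2:ℝ) ^ k * (m i : ℝ) ≤ x i ∧ x i < (2:ℝ) ^ k * ((m i : ℝ) + 1)}

/-- The (closed) axis-parallel cube with center `c` and side length `l`. -/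
def cube {n : ℕ} (c : Rn n) (l : ℝ) : Set (Rn n) :=
  {x : Rn n | ∀ i, |x i - c i| ≤ l / 2}

/-- The average `b_Q = |Q|⁻¹ ∫_Q b`. -/
def avgOn {n : ℕ} (b : Rn n → ℝ) (Q : Set (Rn n)) : ℝ := ⨍ x in Q, b x

/-- `b` has mean oscillation at most `M` on every cube; i.e. `‖b‖_* ≤ M`. -/
def OscBound {n : ℕ} (b : Rn n → ℝ) (M : ℝ) : Prop :=
  ∀ (c : Rn n) (l : ℝ), 0 < l →
    ⨍ x in cube c l, |b x - avgOn b (cube c l)| ≤ M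

/-- A `(1,∞,0)`-atom supported on the set `Q`. -/
def IsH1Atom {n : ℕ} (Q : Set (Rn n)) (a : Rn n → ℝ) : Prop :=
  Measurable a ∧ (∀ x, x ∉ Q → a x = 0) ∧
    (∀ᵐ x ∂volume, |a x| ≤ ((volume Q).toReal)⁻¹) ∧ (∫ x, a x) = 0

/-- The `L¹` norm. -/
def l1norm {n : ℕ} (f : Rn n → ℝ) : ℝ := ∫ x, |f x|

/-- The `L²` norm. -/
def l2norm {n : ℕ} (f : Rn n → ℝ) : ℝ := (∫ x, (f x) ^ 2) ^ ((1:ℝ)/2)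

/-- A finite sum `∑ λ_k a_k` of `(1,∞,0)`-atoms on dyadic cubes with `∑ |λ_k| ≤ 1`. -/
def FiniteAtomicSum {n : ℕ} (f : Rn n → ℝ) : Prop :=
  ∃ (N : ℕ) (Q : Fin N → Set (Rn n)) (a : Fin N → Rn n → ℝ) (lam : Fin N → ℝ),
    (∀ k, IsDyadicCube (Q k)) ∧ (∀ k, IsH1Atom (Q k) (a k)) ∧
    (∑ k, |lam k|) ≤ 1 ∧ ∀ x, f x = ∑ k, lam k * a k x

/-- A bilinear Calderón–Zygmund kernel of `ω` type with constant `C₀` on `ℝⁿ`. -/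
def IsCZKernel2 {n : ℕ} (C₀ : ℝ) (ω : ℝ → ℝ) (K : Rn n → Rn n → Rn n → ℝ) : Prop :=
  (∀ x y₁ y₂ : Rn n, ¬(x = y₁ ∧ y₁ = y₂) →
      |K x y₁ y₂| ≤ C₀ / (‖x - y₁‖ + ‖x - y₂‖) ^ (2 * n)) ∧
  (∀ x x' y₁ y₂ : Rn n, ¬(x = y₁ ∧ y₁ = y₂) →
      ‖x - x'‖ ≤ (1/2) * max ‖x - y₁‖ ‖x - y₂‖ →
      |K x y₁ y₂ - K x' y₁ y₂| ≤
        C₀ / (‖x - y₁‖ + ‖x - y₂‖) ^ (2 * n) * ω (‖x - x'‖ / (‖x - y₁‖ + ‖x - y₂‖))) ∧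
  (∀ x y₁ y₁' y₂ : Rn n, ¬(x = y₁ ∧ y₁ = y₂) →
      ‖y₁ - y₁'‖ ≤ (1/2) * max ‖x - y₁‖ ‖x - y₂‖ →
      |K x y₁ y₂ - K x y₁' y₂| ≤
        C₀ / (‖x - y₁‖ + ‖x - y₂‖) ^ (2 * n) * ω (‖y₁ - y₁'‖ / (‖x - y₁‖ + ‖x - y₂‖))) ∧
  (∀ x y₁ y₂ y₂' : Rn n, ¬(x = y₁ ∧ y₁ = y₂) →
      ‖y₂ - y₂'‖ ≤ (1/2) * max ‖x - y₁‖ ‖x - y₂‖ →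
      |K x y₁ y₂ - K x y₁ y₂'| ≤
        C₀ / (‖x - y₁‖ + ‖x - y₂‖) ^ (2 * n) * ω (‖y₂ - y₂'‖ / (‖x - y₁‖ + ‖x - y₂‖)))

/-- `T` is additive and homogeneous in each of its two entries (on integrable functions). -/
def Bilin2 {n : ℕ} (T : (Rn n → ℝ) → (Rn n → ℝ) → Rn n → ℝ) : Prop :=
  (∀ f f' g : Rn n → ℝ, Integrable f → Integrable f' → Integrable g → ∀ x,
      T (fun y => f y + f' y) g x = T f g x + T f' g x) ∧
  (∀ (r : ℝ) (f g : Rn n → ℝ), Integrable f → Integrable g → ∀ x,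
      T (fun y => r * f y) g x = r * T f g x) ∧
  (∀ f g g' : Rn n → ℝ, Integrable f → Integrable g → Integrable g' → ∀ x,
      T f (fun y => g y + g' y) x = T f g x + T f g' x) ∧
  (∀ (r : ℝ) (f g : Rn n → ℝ), Integrable f → Integrable g → ∀ x,
      T f (fun y => r * g y) x = r * T f g x)

/-- `T` is represented by the kernel `K` off the support of the arguments. -/
def KernelRep2 {n : ℕ} (K : Rn n → Rn n → Rn n → ℝ)
    (T : (Rn n → ℝ) → (Rn n → ℝ) → Rn n → ℝ) : Prop :=
  ∀ f g : Rn n → ℝ, Integrable f → Integrable g →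
    HasCompactSupport f → HasCompactSupport g →
    ∀ᵐ x ∂volume, x ∉ tsupport f ∩ tsupport g →
      T f g x = ∫ y : Rn n × Rn n, K x y.1 y.2 * f y.1 * g y.2

open Metric Filter Topology
open scoped NNReal

/-- The volume of the unit ball of `ℝⁿ`. -/
def unitVol (n : ℕ) : ℝ≥0∞ := volume (ball (0 : Rn n) 1)

lemma unitVol_ne_zero (n : ℕ) : unitVol n ≠ 0 :=
  (measure_ball_pos _ _ one_pos).ne'

lemma unitVol_ne_top (n : ℕ) : unitVol n ≠ ⊤ := measure_ball_lt_top.ne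

lemma volume_closedBall_Rn {n : ℕ} (x : Rn n) {r : ℝ} (hr : 0 ≤ r) :
    volume (closedBall x r) = ENNReal.ofReal (r ^ n) * unitVol n := by
  rw [Measure.addHaar_closedBall volume x hr, finrank_euclideanSpace_fin, unitVol]

lemma volume_closedBall_mul {n : ℕ} (x y : Rn n) {s r : ℝ} (hs : 0 ≤ s) (hr : 0 ≤ r) :
    volume (closedBall x (s * r)) = ENNReal.ofReal (s ^ n) * volume (closedBall y r) := by
  rw [volume_closedBall_Rn x (mul_nonneg hs hr), volume_closedBall_Rn y hr, mul_pow,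
    ENNReal.ofReal_mul (pow_nonneg hs n), mul_assoc]

lemma volume_closedBall_ne_zero {n : ℕ} (x : Rn n) {r : ℝ} (hr : 0 < r) :
    volume (closedBall x r) ≠ 0 :=
  (measure_closedBall_pos _ _ hr).ne'

lemma volume_closedBall_ne_top {n : ℕ} (x : Rn n) (r : ℝ) : volume (closedBall x r) ≠ ⊤ :=
  measure_closedBall_lt_top.ne

/-- Balls of measure at most a fixed finite number have bounded radii. -/
lemma exists_radius_bound {n : ℕ} (hn : 1 ≤ n) {m : ℝ≥0∞} (hm : m ≠ ⊤) :
    ∃ R : ℝ, ∀ (x : Rn n) (r : ℝ), volume (closedBall x r) ≤ m → r ≤ R := by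
  refine ⟨max 1 (m / unitVol n).toReal, fun x r h => ?_⟩
  rcases le_total r 1 with h1 | h1
  · exact h1.trans (le_max_left _ _)
  refine le_trans ?_ (le_max_right _ _)
  rw [volume_closedBall_Rn x (by linarith)] at h
  have hfin : m / unitVol n ≠ ⊤ := ENNReal.div_ne_top hm (unitVol_ne_zero n)
  rw [← ENNReal.ofReal_le_iff_le_toReal hfin]
  refine le_trans (ENNReal.ofReal_le_ofReal (le_self_pow₀ h1 (Nat.one_le_iff_ne_zero.1 hn))) ?_
  exact (ENNReal.le_div_iff_mul_le (Or.inl (unitVol_ne_zero n)) (Or.inl (unitVol_ne_top n))).2 h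

/-- The weak `(1,1)` inequality for the Hardy-Littlewood maximal function. -/
theorem hardyLittlewood_weak {n : ℕ} (hn : 1 ≤ n) (F : Rn n → ℝ≥0∞) (hF : ∫⁻ x, F x ≠ ⊤)
    {a : ℝ≥0∞} (ha : a ≠ 0) (ha' : a ≠ ⊤) :
    volume {x : Rn n | ∃ r : ℝ, 0 < r ∧
      a * volume (closedBall x r) < ∫⁻ y in closedBall x r, F y} ≤
      ENNReal.ofReal (5 ^ n) * ((∫⁻ x, F x) / a) := by
  set S := {x : Rn n | ∃ r : ℝ, 0 < r ∧
      a * volume (closedBall x r) < ∫⁻ y in closedBall x r, F y} with hS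
  choose! r hr0 hr using fun x (hx : x ∈ S) => hx
  obtain ⟨R, hR⟩ := exists_radius_bound hn (ENNReal.div_ne_top hF ha)
  have hvol : ∀ x ∈ S, volume (closedBall x (r x)) ≤ (∫⁻ x, F x) / a := fun x hx => by
    rw [ENNReal.le_div_iff_mul_le (Or.inl ha) (Or.inl ha'), mul_comm]
    exact (hr x hx).le.trans (setLIntegral_le_lintegral _ _)
  obtain ⟨u, huS, hdisj, hcov⟩ := Vitali.exists_disjoint_subfamily_covering_enlargement_closedBall
    S (fun x => x) r R (fun x hx => hR x _ (hvol x hx)) 5 (by norm_num)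
  have hucount : u.Countable := by
    refine hdisj.countable_of_nonempty_interior fun x hx => ?_
    exact ⟨x, ball_subset_interior_closedBall (mem_ball_self (hr0 x (huS hx)))⟩
  have hsub : S ⊆ ⋃ x ∈ u, closedBall x (5 * r x) := fun x hx => by
    obtain ⟨y, hy, hxy⟩ := hcov x hx
    exact mem_biUnion hy (hxy (mem_closedBall_self (hr0 x hx).le))
  have := hucount.to_subtype
  calc volume S ≤ volume (⋃ x ∈ u, closedBall x (5 * r x)) := measure_mono hsub
    _ ≤ ∑' x : u, volume (closedBall (x : Rn n) (5 * r x)) := measure_biUnion_le _ hucount _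
    _ ≤ ∑' x : u, ENNReal.ofReal (5 ^ n) * ((∫⁻ y in closedBall (x : Rn n) (r x), F y) / a) := by
        refine ENNReal.tsum_le_tsum fun x => ?_
        rw [volume_closedBall_mul _ x.1 (by norm_num) (hr0 x (huS x.2)).le]
        gcongr
        rw [ENNReal.le_div_iff_mul_le (Or.inl ha) (Or.inl ha'), mul_comm]
        exact (hr x (huS x.2)).le
    _ = ENNReal.ofReal (5 ^ n) * ((∫⁻ y in ⋃ x ∈ u, closedBall (x : Rn n) (r x), F y) / a) := by
        rw [ENNReal.tsum_mul_left, lintegral_biUnion hucount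
          (fun x _ => measurableSet_closedBall) hdisj]
        simp only [div_eq_mul_inv, ENNReal.tsum_mul_right]
    _ ≤ _ := by
        gcongr
        exact Measure.restrict_le_self

/-- A closed ball centred in another closed ball, of smaller radius, meets it in a proportion of
at least `2⁻ⁿ`. -/
lemma volume_inter_closedBall_ge {n : ℕ} {x y : Rn n} {r s : ℝ} (hs : 0 < s) (hsr : s ≤ r)
    (hy : y ∈ closedBall x r) :
    ENNReal.ofReal ((1 / 2) ^ n) * volume (closedBall y s) ≤
      volume (closedBall x r ∩ closedBall y s) := by
  have hr : 0 < r := hs.trans_le hsr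
  set z : Rn n := y + (s / (2 * r)) • (x - y) with hz
  have hxy : ‖x - y‖ ≤ r := by
    rw [mem_closedBall, dist_eq_norm, norm_sub_rev] at hy; exact hy
  rw [← volume_closedBall_mul z y (by norm_num) hs.le]
  have hsr' : s / (2 * r) ≤ 1 / 2 := by
    rw [div_le_div_iff₀ (by positivity) (by norm_num)]; linarith
  have hs0 : 0 ≤ s / (2 * r) := by positivity
  have key : s / (2 * r) * r = s / 2 := by field_simp
  refine measure_mono (subset_inter (closedBall_subset_closedBall' ?_)
    (closedBall_subset_closedBall' ?_))
  · have : z - x = (1 - s / (2 * r)) • (y - x) := by rw [hz]; module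
    rw [dist_eq_norm, this, norm_smul, Real.norm_of_nonneg (by linarith), norm_sub_rev]
    nlinarith
  · have : z - y = (s / (2 * r)) • (x - y) := by rw [hz]; module
    rw [dist_eq_norm, this, norm_smul, Real.norm_of_nonneg hs0]
    nlinarith

/-- The threshold used in the John-Strömberg inequality. -/
def jsEps (n : ℕ) : ℝ := (1 / 2) ^ (n + 2) * (1 / 10) ^ n

lemma jsEps_pos (n : ℕ) : 0 < jsEps n := by unfold jsEps; positivity

/-- A function oscillates little, in measure, on the ball `closedBall x r` around `c`. -/
def SmallOsc {n : ℕ} (G : Rn n → ℝ) (A : ℝ) (x : Rn n) (r c : ℝ) : Prop :=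
  volume {y | y ∈ closedBall x r ∧ A < |G y - c|} ≤
    ENNReal.ofReal (jsEps n) * volume (closedBall x r)

/-- For almost every point of a set that is small in a ball, there is a scale at which the set has
density at least `τ` around the point, but less than `τ` at five times that scale. -/
lemma ae_exists_stopping_radius {n : ℕ} (hn : 1 ≤ n) {E : Set (Rn n)} (hE : volume E ≠ ⊤)
    {τ : ℝ≥0∞} (hτ0 : τ ≠ 0) (hτ : τ < 1) :
    ∀ᵐ y ∂volume.restrict E, ∃ s : ℝ, 0 < s ∧
      τ * volume (closedBall y s) ≤ volume (E ∩ closedBall y s) ∧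
      volume (E ∩ closedBall y (5 * s)) < τ * volume (closedBall y (5 * s)) := by
  filter_upwards [Besicovitch.ae_tendsto_measure_inter_div volume E] with y hy
  have h1 : ∀ᶠ s in 𝓝[>] (0:ℝ), τ < volume (E ∩ closedBall y s) / volume (closedBall y s) :=
    hy.eventually (lt_mem_nhds hτ)
  obtain ⟨s, hs, hs0⟩ := (h1.and self_mem_nhdsWithin).exists
  have hs0 : 0 < s := hs0
  have hs1 : τ * volume (closedBall y s) ≤ volume (E ∩ closedBall y s) := by
    rw [← ENNReal.le_div_iff_mul_le (Or.inl (volume_closedBall_ne_zero y hs0))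
      (Or.inl (volume_closedBall_ne_top y s))]
    exact hs.le
  by_contra! hcon
  have hall : ∀ k : ℕ, τ * volume (closedBall y (5 ^ k * s)) ≤
      volume (E ∩ closedBall y (5 ^ k * s)) := by
    intro k
    induction k with
    | zero => simpa using hs1
    | succ k ih =>
      have := hcon (5 ^ k * s) (by positivity) ih
      rwa [← mul_assoc, ← pow_succ'] at this
  obtain ⟨R, hR⟩ := exists_radius_bound hn (ENNReal.div_ne_top hE hτ0)
  have hb : ∀ k : ℕ, 5 ^ k * s ≤ R := fun k => by
    refine hR y _ ?_
    rw [ENNReal.le_div_iff_mul_le (Or.inl hτ0) (Or.inl hτ.ne_top), mul_comm]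
    exact (hall k).trans (measure_mono inter_subset_left)
  obtain ⟨k, hk⟩ := pow_unbounded_of_one_lt (R / s) (by norm_num : (1:ℝ) < 5)
  rw [div_lt_iff₀ hs0] at hk
  exact absurd (hb k) (not_le.2 hk)

/-- The John-Strömberg inequality: small oscillation in measure on every ball implies exponential
decay of the distribution function of the oscillation. -/
theorem johnStromberg {n : ℕ} (hn : 1 ≤ n) {G : Rn n → ℝ} (hG : AEMeasurable G) {A : ℝ}
    (hA : 0 ≤ A) (hosc : ∀ (x : Rn n) (r : ℝ), 0 < r → ∃ c, SmallOsc G A x r c) (k : ℕ) :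
    ∀ (x : Rn n) (r c : ℝ), 0 < r → SmallOsc G A x r c →
      volume {y | y ∈ closedBall x r ∧ (2 * k + 1) * A < |G y - c|} ≤
        ENNReal.ofReal ((1 / 2) ^ k) * volume (closedBall x r) := by
  induction k with
  | zero =>
    intro x r c hr _
    rw [pow_zero, ENNReal.ofReal_one, one_mul]
    exact measure_mono fun y hy => hy.1
  | succ k ih =>
    intro x r c hr hc
    set E := {y | y ∈ closedBall x r ∧ A < |G y - c|} with hEdef
    have hEnull : NullMeasurableSet E := by
      refine measurableSet_closedBall.nullMeasurableSet.inter ?_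
      exact nullMeasurableSet_lt aemeasurable_const (hG.sub_const c).abs
    have hEfin : volume E ≠ ⊤ :=
      ((measure_mono (sep_subset _ _)).trans_lt measure_closedBall_lt_top).ne
    set τ : ℝ := (1 / 2) ^ (n + 1) with hτ
    have hτpos : 0 < τ := by positivity
    have hτ1 : τ < 1 := pow_lt_one₀ (by norm_num) (by norm_num) (by omega)
    have hτ0 : ENNReal.ofReal τ ≠ 0 := by simpa using hτpos
    have hae := ae_exists_stopping_radius hn hEfin hτ0 (by simpa using hτ1)
    set S := {y | y ∈ E ∧ ∃ s : ℝ, 0 < s ∧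
      ENNReal.ofReal τ * volume (closedBall y s) ≤ volume (E ∩ closedBall y s) ∧
      volume (E ∩ closedBall y (5 * s)) < ENNReal.ofReal τ * volume (closedBall y (5 * s))}
      with hSdef
    choose! s hs0 hs1 hs2 using fun y (hy : y ∈ S) => hy.2
    have heps : jsEps n = τ * (1 / 2) * (1 / 10) ^ n := by rw [jsEps, hτ]; ring
    have hsR : ∀ y ∈ S, 5 * s y ≤ r := fun y hy => by
      have h1 := (hs1 y hy).trans ((measure_mono inter_subset_left).trans hc)
      rw [volume_closedBall_Rn y (hs0 y hy).le, volume_closedBall_Rn x hr.le, ← mul_assoc,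
        ← mul_assoc, ENNReal.mul_le_mul_iff_left (unitVol_ne_zero n) (unitVol_ne_top n),
        ← ENNReal.ofReal_mul hτpos.le, ← ENNReal.ofReal_mul (jsEps_pos n).le,
        ENNReal.ofReal_le_ofReal_iff (by have := jsEps_pos n; positivity), heps] at h1
      have h2 : (s y) ^ n ≤ (1 / 10 * r) ^ n := by
        rw [mul_pow]
        have : τ * s y ^ n ≤ τ * ((1 / 10) ^ n * r ^ n) := by
          refine h1.trans ?_
          have : 0 ≤ τ * ((1 / 10) ^ n * r ^ n) := by positivity
          linarith
        exact le_of_mul_le_mul_left this hτpos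
      have h3 := le_of_pow_le_pow_left₀ (by omega) (by positivity) h2
      linarith
    obtain ⟨u, huS, hdisj, hcov⟩ :=
      Vitali.exists_disjoint_subfamily_covering_enlargement_closedBall
        S (fun x => x) s r (fun y hy => by linarith [hsR y hy, hs0 y hy]) 5 (by norm_num)
    have hucount : u.Countable := by
      refine hdisj.countable_of_nonempty_interior fun x hx => ?_
      exact ⟨x, ball_subset_interior_closedBall (mem_ball_self (hs0 x (huS hx)))⟩
    choose! d hd using fun y (hy : y ∈ S) => hosc y (5 * s y) (by linarith [hs0 y hy])
    -- neighbouring constants are close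
    have hclose : ∀ y ∈ S, |c - d y| ≤ 2 * A := fun y hy => by
      have h5 : 0 < 5 * s y := by linarith [hs0 y hy]
      have hP0 := volume_closedBall_ne_zero y h5
      have hPt := volume_closedBall_ne_top y (5 * s y)
      have hlow := volume_inter_closedBall_ge h5 (hsR y hy) hy.1.1
      by_contra hcon
      have hsub : closedBall x r ∩ closedBall y (5 * s y) ⊆
          (E ∩ closedBall y (5 * s y)) ∪
            {z | z ∈ closedBall y (5 * s y) ∧ A < |G z - d y|} := by
        rintro z ⟨hz1, hz2⟩
        by_contra hz
        simp only [mem_union, mem_inter_iff, hEdef, mem_ofPred_eq, not_or, not_and, not_lt] at hz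
        have ha : |G z - c| ≤ A := by
          by_contra h'
          exact hz.1 ⟨hz1, not_le.1 h'⟩ hz2
        have hb := hz.2 hz2
        apply hcon
        have h4 := abs_sub_le c (G z) (d y)
        rw [abs_sub_comm c (G z)] at h4
        linarith
      have := hlow.trans ((measure_mono hsub).trans (measure_union_le _ _))
      have h2 : volume (E ∩ closedBall y (5 * s y)) +
          volume {z | z ∈ closedBall y (5 * s y) ∧ A < |G z - d y|} <
          ENNReal.ofReal τ * volume (closedBall y (5 * s y)) +
          ENNReal.ofReal (jsEps n) * volume (closedBall y (5 * s y)) :=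
        ENNReal.add_lt_add_of_lt_of_le
          ((hd y hy).trans_lt (ENNReal.mul_lt_top ENNReal.ofReal_lt_top hPt.lt_top)).ne
          (hs2 y hy) (hd y hy)
      have h3 := this.trans_lt h2
      rw [← add_mul, ← ENNReal.ofReal_add hτpos.le (jsEps_pos n).le,
        ENNReal.mul_lt_mul_iff_left hP0 hPt, ENNReal.ofReal_lt_ofReal_iff
          (by have := jsEps_pos n; positivity), heps] at h3
      have h4 : (1 / 10 : ℝ) ^ n ≤ 1 := pow_le_one₀ (by norm_num) (by norm_num)
      have h5 : (1 / 2 : ℝ) ^ n = 2 * τ := by rw [hτ]; ring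
      rw [h5] at h3
      nlinarith
    have hES : ∀ᵐ y, y ∈ E → y ∈ S := by
      rw [ae_restrict_iff'₀ hEnull] at hae
      filter_upwards [hae] with y hy hyE using ⟨hyE, hy hyE⟩
    have hsub : ∀ᵐ y, y ∈ {y | y ∈ closedBall x r ∧ (2 * ((k + 1 : ℕ) : ℝ) + 1) * A < |G y - c|} →
        y ∈ ⋃ z ∈ u, {y | y ∈ closedBall z (5 * s z) ∧ (2 * (k : ℝ) + 1) * A < |G y - d z|} := by
      filter_upwards [hES] with y hy hyk
      obtain ⟨hyB, hyk⟩ := hyk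
      push_cast at hyk
      have hyE : y ∈ E := ⟨hyB, by nlinarith [(Nat.cast_nonneg k : (0:ℝ) ≤ k)]⟩
      obtain ⟨z, hz, hyz⟩ := hcov y (hy hyE)
      refine mem_biUnion hz ⟨hyz (mem_closedBall_self (hs0 y (hy hyE)).le), ?_⟩
      have h1 := hclose z (huS hz)
      have h2 := abs_sub_le (G y) (d z) c
      rw [abs_sub_comm (d z)] at h2
      linarith
    calc volume {y | y ∈ closedBall x r ∧ (2 * ((k + 1 : ℕ) : ℝ) + 1) * A < |G y - c|}
        ≤ volume (⋃ z ∈ u, {y | y ∈ closedBall z (5 * s z) ∧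
            (2 * (k : ℝ) + 1) * A < |G y - d z|}) := measure_mono_ae hsub
      _ ≤ ∑' z : u, volume {y | y ∈ closedBall (z : Rn n) (5 * s z) ∧
            (2 * (k : ℝ) + 1) * A < |G y - d z|} := measure_biUnion_le _ hucount _
      _ ≤ ∑' z : u, ENNReal.ofReal ((1 / 2) ^ k * 5 ^ n / τ) *
            volume.restrict E (closedBall (z : Rn n) (s z)) := by
          refine ENNReal.tsum_le_tsum fun z => ?_
          have hzS := huS z.2
          refine (ih z (5 * s z) (d z) (by linarith [hs0 z hzS]) (hd z hzS)).trans ?_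
          rw [volume_closedBall_mul _ z.1 (by norm_num) (hs0 z hzS).le,
            Measure.restrict_apply measurableSet_closedBall, inter_comm]
          refine le_trans (le_of_eq ?_) (mul_le_mul_right (hs1 z hzS) _)
          rw [← mul_assoc, ← mul_assoc, ← ENNReal.ofReal_mul (by positivity),
            ← ENNReal.ofReal_mul (by positivity)]
          congr 2
          field_simp
      _ = ENNReal.ofReal ((1 / 2) ^ k * 5 ^ n / τ) *
            volume.restrict E (⋃ z ∈ u, closedBall (z : Rn n) (s z)) := by
          rw [ENNReal.tsum_mul_left, measure_biUnion hucount hdisj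
            (fun x _ => measurableSet_closedBall)]
      _ ≤ ENNReal.ofReal ((1 / 2) ^ k * 5 ^ n / τ) *
            (ENNReal.ofReal (jsEps n) * volume (closedBall x r)) := by
          gcongr
          refine (measure_mono (subset_univ _)).trans ?_
          rw [Measure.restrict_apply_univ]
          exact hc
      _ ≤ ENNReal.ofReal ((1 / 2) ^ (k + 1)) * volume (closedBall x r) := by
          rw [← mul_assoc, ← ENNReal.ofReal_mul (by positivity)]
          gcongr
          rw [heps]
          have h1 : (1 / 10 : ℝ) ^ n * 5 ^ n = (1 / 2) ^ n := by
            rw [← mul_pow]; norm_num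
          have h2 : (1 / 2 : ℝ) ^ n ≤ 1 := pow_le_one₀ (by norm_num) (by norm_num)
          calc (1 / 2 : ℝ) ^ k * 5 ^ n / τ * (τ * (1 / 2) * (1 / 10) ^ n)
              = (1 / 2) ^ (k + 1) * ((1 / 10 : ℝ) ^ n * 5 ^ n) := by
                rw [pow_succ]; field_simp
            _ ≤ (1 / 2) ^ (k + 1) * 1 := by rw [h1]; gcongr
            _ = _ := mul_one _

/-- Integral form of the John-Strömberg inequality. -/
theorem johnStromberg_sq {n : ℕ} (hn : 1 ≤ n) : ∃ C : ℝ≥0, ∀ {G : Rn n → ℝ}, AEMeasurable G →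
    ∀ {A : ℝ}, 0 < A → (∀ (x : Rn n) (r : ℝ), 0 < r → ∃ c, SmallOsc G A x r c) →
    ∀ (x : Rn n) (r c : ℝ), 0 < r → SmallOsc G A x r c →
      ∫⁻ y in closedBall x r, ENNReal.ofReal ((G y - c) ^ 2) ≤
        C * ENNReal.ofReal (A ^ 2) * volume (closedBall x r) := by
  have hsum : Summable fun k : ℕ => (2 * (k : ℝ) + 3) ^ 2 * (1 / 2) ^ k := by
    have h2 := summable_pow_mul_geometric_of_norm_lt_one 2 (r := (1 / 2 : ℝ)) (by norm_num)
    have h1 := summable_pow_mul_geometric_of_norm_lt_one 1 (r := (1 / 2 : ℝ)) (by norm_num)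
    have h0 := summable_pow_mul_geometric_of_norm_lt_one 0 (r := (1 / 2 : ℝ)) (by norm_num)
    refine (((h2.mul_left 4).add (h1.mul_left 12)).add (h0.mul_left 9)).congr fun k => ?_
    ring
  have hfin := hsum.tsum_ofReal_ne_top
  refine ⟨1 + (∑' k : ℕ, ENNReal.ofReal ((2 * (k : ℝ) + 3) ^ 2 * (1 / 2) ^ k)).toNNReal, ?_⟩
  intro G hG A hA hosc x r c hr hc
  rw [ENNReal.coe_add, ENNReal.coe_one, ENNReal.coe_toNNReal hfin]
  set D : ℕ → Set (Rn n) := fun k => {y | (2 * (k : ℝ) + 1) * A < |G y - c|} with hD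
  have hDnull : ∀ k, NullMeasurableSet (D k) := fun k =>
    nullMeasurableSet_lt aemeasurable_const (hG.sub_const c).abs
  have hpt : ∀ y, ENNReal.ofReal ((G y - c) ^ 2) ≤ ENNReal.ofReal (A ^ 2) +
      ∑' k : ℕ, (D k).indicator (fun _ => ENNReal.ofReal (((2 * (k : ℝ) + 3) * A) ^ 2)) y := by
    intro y
    by_cases hy : |G y - c| ≤ A
    · refine le_add_right (ENNReal.ofReal_le_ofReal ?_)
      rw [← sq_abs]
      gcongr
    · have hex : ∃ k : ℕ, |G y - c| ≤ (2 * (k : ℝ) + 3) * A := by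
        obtain ⟨k, hk⟩ := exists_nat_ge (|G y - c| / A)
        refine ⟨k, ?_⟩
        rw [div_le_iff₀ hA] at hk
        nlinarith [(Nat.cast_nonneg k : (0:ℝ) ≤ k)]
      classical
      set k := Nat.find hex with hk
      have hk1 := Nat.find_spec hex
      have hmem : y ∈ D k := by
        rw [hD]
        rcases Nat.eq_zero_or_pos k with h0 | h0
        · simp only [h0, mem_ofPred_eq]; push_cast; linarith
        · have := Nat.find_min hex (m := k - 1) (by omega)
          rw [Nat.cast_sub h0] at this
          push_cast at this
          simp only [mem_ofPred_eq]
          linarith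
      refine le_add_left (le_trans ?_ (ENNReal.le_tsum k))
      rw [indicator_of_mem hmem]
      refine ENNReal.ofReal_le_ofReal ?_
      rw [← sq_abs]
      gcongr
  calc ∫⁻ y in closedBall x r, ENNReal.ofReal ((G y - c) ^ 2)
      ≤ ∫⁻ y in closedBall x r, (ENNReal.ofReal (A ^ 2) + ∑' k : ℕ,
          (D k).indicator (fun _ => ENNReal.ofReal (((2 * (k : ℝ) + 3) * A) ^ 2)) y) :=
        lintegral_mono fun y => hpt y
    _ = ENNReal.ofReal (A ^ 2) * volume (closedBall x r) + ∑' k : ℕ,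
          ENNReal.ofReal (((2 * (k : ℝ) + 3) * A) ^ 2) * volume (closedBall x r ∩ D k) := by
        rw [lintegral_add_left measurable_const, lintegral_const, Measure.restrict_apply_univ,
          lintegral_tsum]
        · congr 1
          refine tsum_congr fun k => ?_
          rw [lintegral_indicator_const₀ ((hDnull k).mono_ac Measure.restrict_le_self.absolutelyContinuous),
            Measure.restrict_apply₀' measurableSet_closedBall.nullMeasurableSet, inter_comm]
        · intro k
          exact (aemeasurable_const.indicator₀
            ((hDnull k).mono_ac Measure.restrict_le_self.absolutelyContinuous))
    _ ≤ ENNReal.ofReal (A ^ 2) * volume (closedBall x r) + ∑' k : ℕ,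
          ENNReal.ofReal ((2 * (k : ℝ) + 3) ^ 2 * (1 / 2) ^ k) *
            (ENNReal.ofReal (A ^ 2) * volume (closedBall x r)) := by
        refine add_le_add le_rfl (ENNReal.tsum_le_tsum fun k => ?_)
        refine (mul_le_mul_right (johnStromberg hn hG hA.le hosc k x r c hr hc) _).trans ?_
        rw [← mul_assoc, ← mul_assoc, ← ENNReal.ofReal_mul (by positivity),
          ← ENNReal.ofReal_mul (by positivity)]
        refine le_of_eq ?_
        congr 2
        ring
    _ = _ := by
        rw [ENNReal.tsum_mul_right]
        ring

/-- Integration of a radially decreasing function over dyadic shells. -/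
lemma lintegral_dyadic_shell {X : Type*} [MeasurableSpace X] (μ : Measure X) (F : X → ℝ≥0∞)
    {ρ : X → ℝ} (hρ : Measurable ρ) {R : ℝ} (hR : 0 < R) {φ : ℝ → ℝ≥0∞}
    (hφ : AntitoneOn φ (Ici R)) (hφt : ∀ t, φ t ≠ ⊤) {m : ℕ → ℝ≥0∞}
    (hm : ∀ i : ℕ, ∫⁻ x in {x | ρ x ≤ 2 ^ (i + 1) * R}, F x ∂μ ≤ m i) :
    ∫⁻ x in {x | R ≤ ρ x}, F x * φ (ρ x) ∂μ ≤ ∑' i : ℕ, φ (2 ^ i * R) * m i := by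
  set s : ℕ → Set X := fun i => {x | 2 ^ i * R ≤ ρ x ∧ ρ x ≤ 2 ^ (i + 1) * R} with hs
  have hsm : ∀ i, MeasurableSet (s i) := fun i =>
    (measurableSet_le measurable_const hρ).inter (measurableSet_le hρ measurable_const)
  have hsub : {x | R ≤ ρ x} ⊆ ⋃ i, s i := by
    intro x hx
    have hx : R ≤ ρ x := hx
    obtain ⟨i, hi1, hi2⟩ := exists_nat_pow_near ((one_le_div hR).2 hx) (by norm_num : (1:ℝ) < 2)
    rw [le_div_iff₀ hR] at hi1
    rw [div_lt_iff₀ hR] at hi2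
    exact mem_iUnion.2 ⟨i, hi1, hi2.le⟩
  calc ∫⁻ x in {x | R ≤ ρ x}, F x * φ (ρ x) ∂μ ≤ ∫⁻ x in ⋃ i, s i, F x * φ (ρ x) ∂μ :=
        lintegral_mono_set hsub
    _ ≤ ∑' i, ∫⁻ x in s i, F x * φ (ρ x) ∂μ := lintegral_iUnion_le _ _
    _ ≤ ∑' i : ℕ, φ (2 ^ i * R) * m i := by
        refine ENNReal.tsum_le_tsum fun i => ?_
        have h1 : R ≤ 2 ^ i * R := le_mul_of_one_le_left hR.le (one_le_pow₀ (by norm_num))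
        calc ∫⁻ x in s i, F x * φ (ρ x) ∂μ ≤ ∫⁻ x in s i, φ (2 ^ i * R) * F x ∂μ := by
              refine setLIntegral_mono' (hsm i) fun x hx => ?_
              rw [mul_comm]
              gcongr
              exact hφ h1 (h1.trans hx.1) hx.1
          _ = φ (2 ^ i * R) * ∫⁻ x in s i, F x ∂μ := lintegral_const_mul' _ _ (hφt _)
          _ ≤ _ := by
              gcongr
              exact (lintegral_mono_set fun x hx => hx.2).trans (hm i)

/-- The dyadic form of the log-Dini sum. -/
def diniSum (ω : ℝ → ℝ) : ℝ≥0∞ := ∑' i : ℕ, ENNReal.ofReal ((1 + i) * ω ((1 / 2) ^ i))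

lemma diniSum_ne_top {ω : ℝ → ℝ} (hω0 : ∀ t, 0 < t → 0 ≤ ω t)
    (hωmono : ∀ s t : ℝ, 0 < s → s ≤ t → ω s ≤ ω t)
    (hω : IntegrableOn (fun t => ω t * (1 + Real.log (1 / t)) / t) (Ioo (0:ℝ) 1)) :
    diniSum ω ≠ ⊤ := by
  have hfin := Integrable.lintegral_lt_top hω
  rw [diniSum, tsum_eq_zero_add' ENNReal.summable]
  refine ENNReal.add_ne_top.2 ⟨ENNReal.ofReal_ne_top, ?_⟩
  set J : ℕ → Set ℝ := fun i => Ioo ((1 / 2) ^ (i + 1)) ((1 / 2) ^ i) with hJ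
  have hanti : Antitone fun i : ℕ => (1 / 2 : ℝ) ^ i :=
    fun i j hij => pow_le_pow_of_le_one (by norm_num) (by norm_num) hij
  have hdisj : Pairwise (Function.onFun Disjoint J) := hanti.pairwise_disjoint_on_Ioo_succ
  have hsub : ⋃ i, J i ⊆ Ioo (0:ℝ) 1 := by
    refine iUnion_subset fun i t ht => ⟨lt_trans (by positivity) ht.1, ht.2.trans_le ?_⟩
    exact pow_le_one₀ (by norm_num) (by norm_num)
  have hterm : ∀ i : ℕ, ENNReal.ofReal ((1 + ((i + 1 : ℕ) : ℝ)) * ω ((1 / 2) ^ (i + 1))) ≤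
      4 * ∫⁻ t in J i, ENNReal.ofReal (ω t * (1 + Real.log (1 / t)) / t) := by
    intro i
    have hlow : ∀ t ∈ J i, ENNReal.ofReal ((1 + ((i + 1 : ℕ) : ℝ)) * ω ((1 / 2) ^ (i + 1)) / 2 *
        2 ^ i) ≤ ENNReal.ofReal (ω t * (1 + Real.log (1 / t)) / t) := by
      intro t ht
      have ht0 : 0 < t := lt_trans (by positivity) ht.1
      have h1 : 0 ≤ ω ((1 / 2) ^ (i + 1)) := hω0 _ (by positivity)
      have h2 : ω ((1 / 2) ^ (i + 1)) ≤ ω t := hωmono _ _ (by positivity) ht.1.le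
      have h3 : (2:ℝ) ^ i ≤ 1 / t := by
        rw [le_div_iff₀ ht0]
        have := ht.2.le
        rw [one_div, inv_pow] at this
        calc (2:ℝ) ^ i * t ≤ 2 ^ i * (2 ^ i)⁻¹ := by gcongr
          _ = 1 := mul_inv_cancel₀ (by positivity)
      have h4 : (i : ℝ) * Real.log 2 ≤ Real.log (1 / t) := by
        rw [← Real.log_pow]
        exact Real.log_le_log (by positivity) h3
      have h5 : (1 + ((i + 1 : ℕ) : ℝ)) / 2 ≤ 1 + Real.log (1 / t) := by
        have := Real.log_two_gt_d9
        push_cast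
        nlinarith [(Nat.cast_nonneg i : (0:ℝ) ≤ i)]
      refine ENNReal.ofReal_le_ofReal ?_
      rw [div_eq_mul_one_div _ t]
      calc (1 + ((i + 1 : ℕ) : ℝ)) * ω ((1 / 2) ^ (i + 1)) / 2 * 2 ^ i
          = ω ((1 / 2) ^ (i + 1)) * ((1 + ((i + 1 : ℕ) : ℝ)) / 2) * 2 ^ i := by ring
        _ ≤ _ := by
            have h7 : 0 ≤ ω t := h1.trans h2
            have h8 : 0 ≤ 1 + Real.log (1 / t) := le_trans (by positivity) h5
            gcongr
    have h6 := setLIntegral_mono' (μ := volume) measurableSet_Ioo hlow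
    rw [setLIntegral_const, Real.volume_Ioo, ← ENNReal.ofReal_mul (by
      have : 0 ≤ ω ((1 / 2) ^ (i + 1)) := hω0 _ (by positivity)
      positivity)] at h6
    refine le_trans (le_of_eq ?_) (mul_le_mul_right h6 4)
    rw [show (4 : ℝ≥0∞) = ENNReal.ofReal 4 by simp, ← ENNReal.ofReal_mul (by norm_num)]
    congr 1
    rw [pow_succ, one_div, inv_pow]
    field_simp
    ring
  refine ne_top_of_le_ne_top (ENNReal.mul_ne_top (by norm_num : (4 : ℝ≥0∞) ≠ ⊤) hfin.ne)
    ((ENNReal.tsum_le_tsum hterm).trans ?_)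
  rw [ENNReal.tsum_mul_left, ← lintegral_iUnion (fun i => measurableSet_Ioo) hdisj]
  gcongr

/-- A modulus satisfying the log-Dini condition vanishes at the origin. -/
lemma exists_modulus_le {ω : ℝ → ℝ} (hωmono : ∀ s t : ℝ, 0 < s → s ≤ t → ω s ≤ ω t)
    (hfin : diniSum ω ≠ ⊤) {ε : ℝ} (hε : 0 < ε) :
    ∃ δ : ℝ, 0 < δ ∧ ∀ t, 0 < t → t ≤ δ → ω t ≤ ε := by
  have h := ENNReal.tendsto_atTop_zero_of_tsum_ne_top hfin
  have h1 : ∀ᶠ i : ℕ in atTop, ENNReal.ofReal ((1 + i) * ω ((1 / 2) ^ i)) < ENNReal.ofReal ε :=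
    h.eventually (gt_mem_nhds (by simpa using hε))
  obtain ⟨i, hi⟩ := h1.exists
  rw [ENNReal.ofReal_lt_ofReal_iff hε] at hi
  refine ⟨(1 / 2) ^ i, by positivity, fun t ht hti => (hωmono t _ ht hti).trans ?_⟩
  rcases le_total (ω ((1 / 2) ^ i)) 0 with h0 | h0
  · linarith
  · nlinarith [mul_nonneg (Nat.cast_nonneg i : (0:ℝ) ≤ i) h0]

/-- Integration of `ω(R/ρ) ρ⁻ᵈ` against a weight with logarithmically corrected growth. -/
lemma lintegral_far {X : Type*} [MeasurableSpace X] (μ : Measure X) (F : X → ℝ≥0∞) {ρ : X → ℝ}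
    (hρ : Measurable ρ) {R : ℝ} (hR : 0 < R) {ω : ℝ → ℝ} (hω0 : ∀ t, 0 ≤ ω t)
    (hωm : Monotone ω) (d : ℕ) {a : ℝ≥0∞}
    (hm : ∀ i : ℕ, ∫⁻ x in {x | ρ x ≤ 2 ^ (i + 1) * R}, F x ∂μ ≤
      ENNReal.ofReal (1 + i) * a * ENNReal.ofReal ((2 ^ i * R) ^ d)) :
    ∫⁻ x in {x | R ≤ ρ x}, F x * ENNReal.ofReal (ω (R / ρ x) / ρ x ^ d) ∂μ ≤ a * diniSum ω := by
  have hφ : AntitoneOn (fun t : ℝ => ENNReal.ofReal (ω (R / t) / t ^ d)) (Ici R) := by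
    intro s hs t ht hst
    have hs0 : 0 < s := hR.trans_le hs
    refine ENNReal.ofReal_le_ofReal ?_
    refine div_le_div₀ (hω0 _) (hωm ?_) (by positivity) ?_
    · gcongr
    · gcongr
  refine (lintegral_dyadic_shell μ F hρ hR hφ (fun _ => ENNReal.ofReal_ne_top) hm).trans
    (le_of_eq ?_)
  rw [diniSum, ← ENNReal.tsum_mul_left]
  refine tsum_congr fun i => ?_
  have h1 : R / (2 ^ i * R) = (1 / 2) ^ i := by
    rw [one_div, inv_pow]; field_simp
  have h2 : 0 ≤ ω ((1 / 2) ^ i) := hω0 _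
  simp only [h1]
  rw [mul_comm (ENNReal.ofReal (1 + (i : ℝ))) a, mul_assoc, ← ENNReal.ofReal_mul (by positivity),
    mul_left_comm, ← ENNReal.ofReal_mul (by positivity)]
  congr 2
  field_simp

lemma setOf_norm_sub_le {n : ℕ} (c : Rn n) (t : ℝ) : {x : Rn n | ‖x - c‖ ≤ t} = closedBall c t := by
  ext x; simp [mem_closedBall, dist_eq_norm]

/-- `lintegral_far` on `ℝⁿ`. -/
lemma lintegral_far_Rn {n : ℕ} (F : Rn n → ℝ≥0∞) (c : Rn n) {R : ℝ} (hR : 0 < R) {ω : ℝ → ℝ}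
    (hω0 : ∀ t, 0 ≤ ω t) (hωm : Monotone ω) {a : ℝ≥0∞}
    (hm : ∀ i : ℕ, ∫⁻ x in closedBall c (2 ^ (i + 1) * R), F x ≤
      ENNReal.ofReal (1 + i) * a * ENNReal.ofReal ((2 ^ i * R) ^ n)) :
    ∫⁻ x in {x | R ≤ ‖x - c‖}, F x * ENNReal.ofReal (ω (R / ‖x - c‖) / ‖x - c‖ ^ n) ≤
      a * diniSum ω := by
  refine lintegral_far volume F (ρ := fun x : Rn n => ‖x - c‖) (by fun_prop) hR hω0 hωm n ?_
  simpa only [setOf_norm_sub_le] using hm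

/-- The unweighted version of `lintegral_far_Rn`. -/
lemma lintegral_far_one {n : ℕ} (c : Rn n) {R : ℝ} (hR : 0 < R) {ω : ℝ → ℝ}
    (hω0 : ∀ t, 0 ≤ ω t) (hωm : Monotone ω) :
    ∫⁻ x in {x | R ≤ ‖x - c‖}, ENNReal.ofReal (ω (R / ‖x - c‖) / ‖x - c‖ ^ n) ≤
      ENNReal.ofReal (2 ^ n) * unitVol n * diniSum ω := by
  have := lintegral_far_Rn (fun _ => 1) c hR hω0 hωm (a := ENNReal.ofReal (2 ^ n) * unitVol n) ?_
  · simpa using this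
  · intro i
    rw [setLIntegral_const, one_mul, volume_closedBall_Rn _ (by positivity)]
    calc ENNReal.ofReal ((2 ^ (i + 1) * R) ^ n) * unitVol n
        = 1 * (ENNReal.ofReal (2 ^ n) * unitVol n) * ENNReal.ofReal ((2 ^ i * R) ^ n) := by
          rw [one_mul, mul_right_comm, ← ENNReal.ofReal_mul (by positivity)]
          congr 2
          rw [← mul_pow]; ring
      _ ≤ _ := by
          gcongr
          rw [← ENNReal.ofReal_one]
          exact ENNReal.ofReal_le_ofReal (by linarith [(Nat.cast_nonneg i : (0:ℝ) ≤ i)])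

/-- A Poisson-type integral is controlled by averages over large balls. -/
lemma lintegral_poisson {n : ℕ} (hn : 1 ≤ n) {F : Rn n → ℝ≥0∞} {x : Rn n} {r : ℝ} (hr : 0 < r)
    {a : ℝ≥0∞} (hF : ∀ s, r ≤ s → ∫⁻ y in closedBall x s, F y ≤ a * volume (closedBall x s)) :
    ∫⁻ y, F y * ENNReal.ofReal (1 / (r + ‖x - y‖) ^ (2 * n)) ≤
      a * unitVol n * ENNReal.ofReal (2 ^ (n + 1) / r ^ n) := by
  have hφ : AntitoneOn (fun t : ℝ => ENNReal.ofReal (1 / t ^ (2 * n))) (Ici r) := by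
    intro s hs t ht hst
    have hs0 : 0 < s := hr.trans_le hs
    refine ENNReal.ofReal_le_ofReal ?_
    gcongr
  have hall : {y : Rn n | r ≤ r + ‖x - y‖} = univ := by
    ext y; simp
  have key := lintegral_dyadic_shell volume F (ρ := fun y : Rn n => r + ‖x - y‖) (by fun_prop) hr hφ
    (fun _ => ENNReal.ofReal_ne_top)
    (m := fun i => a * unitVol n * ENNReal.ofReal ((2 ^ (i + 1) * r) ^ n)) ?_
  · rw [hall, Measure.restrict_univ] at key
    refine key.trans ?_
    have hterm : ∀ i : ℕ, ENNReal.ofReal (1 / (2 ^ i * r) ^ (2 * n)) *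
        (a * unitVol n * ENNReal.ofReal ((2 ^ (i + 1) * r) ^ n)) ≤
        a * unitVol n * ENNReal.ofReal (2 ^ n / r ^ n * (1 / 2) ^ i) := by
      intro i
      rw [mul_left_comm, ← ENNReal.ofReal_mul (by positivity)]
      refine mul_le_mul_right (ENNReal.ofReal_le_ofReal ?_) _
      have h1 : (1:ℝ) / (2 ^ i * r) ^ (2 * n) * (2 ^ (i + 1) * r) ^ n =
          2 ^ n / r ^ n * ((1 / 2) ^ i) ^ n := by
        rw [two_mul n, pow_add, pow_succ (2:ℝ) i, mul_pow, mul_pow, mul_pow, one_div_pow, div_pow,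
          one_pow]
        field_simp
      rw [h1]
      refine mul_le_mul_of_nonneg_left ?_ (by positivity)
      exact pow_le_of_le_one (by positivity) (pow_le_one₀ (by norm_num) (by norm_num)) (by omega)
    refine (ENNReal.tsum_le_tsum hterm).trans (le_of_eq ?_)
    rw [ENNReal.tsum_mul_left]
    congr 1
    rw [← ENNReal.ofReal_tsum_of_nonneg (fun i => by positivity)
      ((summable_geometric_of_lt_one (by norm_num) (by norm_num)).mul_left _), tsum_mul_left,
      tsum_geometric_two]
    congr 1
    ring
  · intro i
    have hs : r ≤ 2 ^ (i + 1) * r := le_mul_of_one_le_left hr.le (one_le_pow₀ (by norm_num))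
    calc ∫⁻ y in {y | r + ‖x - y‖ ≤ 2 ^ (i + 1) * r}, F y
        ≤ ∫⁻ y in closedBall x (2 ^ (i + 1) * r), F y := by
          refine lintegral_mono_set fun y hy => ?_
          rw [mem_closedBall', dist_eq_norm]
          have hy : r + ‖x - y‖ ≤ 2 ^ (i + 1) * r := hy
          linarith
      _ ≤ _ := by
          refine (hF _ hs).trans (le_of_eq ?_)
          rw [volume_closedBall_Rn _ (by positivity)]
          ring

/-- `lintegral_far` on `ℝⁿ × ℝⁿ`. -/
lemma lintegral_far_prod {n : ℕ} (x : Rn n) {R : ℝ} (hR : 0 < R) {ω : ℝ → ℝ}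
    (hω0 : ∀ t, 0 ≤ ω t) (hωm : Monotone ω) :
    ∫⁻ p in {p : Rn n × Rn n | R ≤ max ‖x - p.1‖ ‖x - p.2‖},
      ENNReal.ofReal (ω (R / max ‖x - p.1‖ ‖x - p.2‖) / max ‖x - p.1‖ ‖x - p.2‖ ^ (2 * n)) ≤
      ENNReal.ofReal (4 ^ n) * unitVol n ^ 2 * diniSum ω := by
  have := lintegral_far (volume : Measure (Rn n × Rn n)) (fun _ => 1)
    (ρ := fun p : Rn n × Rn n => max ‖x - p.1‖ ‖x - p.2‖) (by fun_prop) hR hω0 hωm (2 * n)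
    (a := ENNReal.ofReal (4 ^ n) * unitVol n ^ 2) ?_
  · simpa using this
  · intro i
    have hset : {p : Rn n × Rn n | max ‖x - p.1‖ ‖x - p.2‖ ≤ 2 ^ (i + 1) * R} =
        closedBall x (2 ^ (i + 1) * R) ×ˢ closedBall x (2 ^ (i + 1) * R) := by
      ext p
      simp [dist_eq_norm, norm_sub_rev x]
    rw [setLIntegral_const, one_mul, hset, Measure.volume_eq_prod, Measure.prod_prod,
      volume_closedBall_Rn _ (by positivity)]
    calc ENNReal.ofReal ((2 ^ (i + 1) * R) ^ n) * unitVol n *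
          (ENNReal.ofReal ((2 ^ (i + 1) * R) ^ n) * unitVol n)
        = 1 * (ENNReal.ofReal (4 ^ n) * unitVol n ^ 2) * ENNReal.ofReal ((2 ^ i * R) ^ (2 * n)) := by
          rw [one_mul, mul_mul_mul_comm, ← ENNReal.ofReal_mul (by positivity), mul_right_comm,
            ← ENNReal.ofReal_mul (by positivity), sq]
          congr 2
          rw [two_mul n, pow_add (_ : ℝ) n n, ← mul_pow, ← mul_pow, ← mul_pow]
          ring
      _ ≤ _ := by
          gcongr
          rw [← ENNReal.ofReal_one]
          exact ENNReal.ofReal_le_ofReal (by linarith [(Nat.cast_nonneg i : (0:ℝ) ≤ i)])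

lemma cube_eq_preimage {n : ℕ} (c : Rn n) (l : ℝ) :
    cube c l = WithLp.ofLp ⁻¹' Icc (fun i => c i - l / 2) (fun i => c i + l / 2) := by
  ext x
  simp only [cube, mem_ofPred_eq, mem_preimage, mem_Icc, Pi.le_def, abs_le]
  constructor
  · intro h
    exact ⟨fun i => by linarith [(h i).1], fun i => by linarith [(h i).2]⟩
  · rintro ⟨h1, h2⟩ i
    exact ⟨by linarith [h1 i], by linarith [h2 i]⟩

lemma volume_cube {n : ℕ} (c : Rn n) {l : ℝ} (hl : 0 ≤ l) :
    volume (cube c l) = ENNReal.ofReal (l ^ n) := by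
  rw [cube_eq_preimage, (PiLp.volume_preserving_ofLp (Fin n)).measure_preimage
    measurableSet_Icc.nullMeasurableSet, Real.volume_Icc_pi]
  simp only [add_sub_sub_cancel, add_halves]
  rw [Finset.prod_const, Finset.card_univ, Fintype.card_fin, ENNReal.ofReal_pow hl]

lemma norm_le_sum_abs {n : ℕ} (v : Rn n) : ‖v‖ ≤ ∑ i, |v i| := by
  rw [EuclideanSpace.norm_eq]
  refine Real.sqrt_le_iff.2 ⟨Finset.sum_nonneg fun i _ => abs_nonneg _, ?_⟩
  exact Finset.sum_sq_le_sq_sum_of_nonneg fun i _ => abs_nonneg _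

lemma closedBall_subset_cube {n : ℕ} (c : Rn n) (r : ℝ) : closedBall c r ⊆ cube c (2 * r) := by
  intro x hx i
  rw [mem_closedBall, dist_eq_norm] at hx
  have := (PiLp.norm_apply_le (x - c) i).trans hx
  rw [Real.norm_eq_abs, PiLp.sub_apply] at this
  linarith

lemma cube_subset_cube {n : ℕ} (c : Rn n) {l l' : ℝ} (h : l ≤ l') : cube c l ⊆ cube c l' :=
  fun _ hx i => (hx i).trans (by linarith)

lemma cube_subset_closedBall {n : ℕ} (c : Rn n) (l : ℝ) : cube c l ⊆ closedBall c (n * (l / 2)) := by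
  intro x hx
  rw [mem_closedBall, dist_eq_norm]
  refine (norm_le_sum_abs _).trans ?_
  calc ∑ i, |(x - c) i| ≤ ∑ _i : Fin n, l / 2 := Finset.sum_le_sum fun i _ => hx i
    _ = _ := by simp

lemma integrableOn_cube {n : ℕ} {b : Rn n → ℝ} (hb : LocallyIntegrable b volume) (c : Rn n) (l : ℝ) :
    IntegrableOn b (cube c l) :=
  (hb.integrableOn_isCompact (isCompact_closedBall c _)).mono_set (cube_subset_closedBall c l)

lemma lintegral_cube_le {n : ℕ} {b : Rn n → ℝ} (hb : LocallyIntegrable b volume) {M : ℝ}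
    (hosc : OscBound b M) (c : Rn n) {l : ℝ} (hl : 0 < l) :
    ∫⁻ x in cube c l, ENNReal.ofReal |b x - avgOn b (cube c l)| ≤ ENNReal.ofReal (M * l ^ n) := by
  have hint : IntegrableOn (fun x => |b x - avgOn b (cube c l)|) (cube c l) := by
    refine ((integrableOn_cube hb c l).sub (integrableOn_const ?_)).abs
    rw [volume_cube _ hl.le]
    exact ENNReal.ofReal_ne_top
  rw [← ofReal_integral_eq_lintegral_ofReal hint (ae_of_all _ fun x => abs_nonneg _)]
  refine ENNReal.ofReal_le_ofReal ?_
  have h := hosc c l hl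
  rw [setAverage_eq, measureReal_def, volume_cube _ hl.le, ENNReal.toReal_ofReal (by positivity),
    smul_eq_mul, inv_mul_le_iff₀ (by positivity)] at h
  linarith

/-- The mean value of `b` over the cube circumscribed about a ball. -/
def ballMean {n : ℕ} (b : Rn n → ℝ) (c : Rn n) (r : ℝ) : ℝ := avgOn b (cube c (2 * r))

lemma aemeasurable_of_locallyIntegrable {n : ℕ} {b : Rn n → ℝ} (hb : LocallyIntegrable b volume) :
    AEMeasurable b := hb.aestronglyMeasurable.aemeasurable

lemma abs_ballMean_sub_le {n : ℕ} {b : Rn n → ℝ} (hb : LocallyIntegrable b volume) {M : ℝ}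
    (hM : 0 ≤ M) (hosc : OscBound b M) (c : Rn n) {r : ℝ} (hr : 0 < r) :
    |ballMean b c (2 * r) - ballMean b c r| ≤ M * (1 + 2 ^ n) := by
  set β := ballMean b c r
  set β' := ballMean b c (2 * r)
  have hbm := aemeasurable_of_locallyIntegrable hb
  have h1 : ENNReal.ofReal (|β' - β| * (2 * r) ^ n) ≤
      ENNReal.ofReal (M * (2 * r) ^ n + M * (2 * (2 * r)) ^ n) := by
    calc ENNReal.ofReal (|β' - β| * (2 * r) ^ n)
        = ∫⁻ _ in cube c (2 * r), ENNReal.ofReal |β' - β| := by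
          rw [setLIntegral_const, volume_cube _ (by positivity), ENNReal.ofReal_mul (abs_nonneg _)]
      _ ≤ ∫⁻ x in cube c (2 * r), (ENNReal.ofReal |b x - β| + ENNReal.ofReal |b x - β'|) := by
          refine lintegral_mono fun x => ?_
          rw [← ENNReal.ofReal_add (abs_nonneg _) (abs_nonneg _)]
          refine ENNReal.ofReal_le_ofReal ?_
          rw [abs_sub_comm (b x) β']
          linarith [abs_sub_le β' (b x) β]
      _ = (∫⁻ x in cube c (2 * r), ENNReal.ofReal |b x - β|) +
          ∫⁻ x in cube c (2 * r), ENNReal.ofReal |b x - β'| :=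
          lintegral_add_left' ((hbm.sub_const _).abs.ennreal_ofReal.restrict) _
      _ ≤ (∫⁻ x in cube c (2 * r), ENNReal.ofReal |b x - β|) +
          ∫⁻ x in cube c (2 * (2 * r)), ENNReal.ofReal |b x - β'| := by
          gcongr
          exact cube_subset_cube c (by linarith)
      _ ≤ _ := by
          rw [ENNReal.ofReal_add (by positivity) (by positivity)]
          exact add_le_add (lintegral_cube_le hb hosc c (by positivity))
            (lintegral_cube_le hb hosc c (by positivity))
  rw [ENNReal.ofReal_le_ofReal_iff (by positivity)] at h1
  have h2 : (0:ℝ) < (2 * r) ^ n := by positivity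
  rw [mul_pow 2 (2 * r)] at h1
  refine le_of_mul_le_mul_right ?_ h2
  linarith

lemma abs_ballMean_sub_pow_le {n : ℕ} {b : Rn n → ℝ} (hb : LocallyIntegrable b volume) {M : ℝ}
    (hM : 0 ≤ M) (hosc : OscBound b M) (c : Rn n) {r : ℝ} (hr : 0 < r) (i : ℕ) :
    |ballMean b c (2 ^ i * r) - ballMean b c r| ≤ i * (M * (1 + 2 ^ n)) := by
  induction i with
  | zero => simp
  | succ i ih =>
    have h := abs_ballMean_sub_le hb hM hosc c (r := 2 ^ i * r) (by positivity)
    rw [← mul_assoc, ← pow_succ'] at h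
    push_cast
    linarith [abs_sub_le (ballMean b c (2 ^ (i + 1) * r)) (ballMean b c (2 ^ i * r))
      (ballMean b c r)]

/-- Growth of the mean oscillation of a BMO function over dilated balls. -/
lemma lintegral_bmo_le {n : ℕ} {b : Rn n → ℝ} (hb : LocallyIntegrable b volume) {M : ℝ}
    (hM : 0 ≤ M) (hosc : OscBound b M) (c : Rn n) {r : ℝ} (hr : 0 < r) (i : ℕ) :
    ∫⁻ x in closedBall c (2 ^ i * r), ENNReal.ofReal |b x - ballMean b c r| ≤
      ENNReal.ofReal ((1 + i) * (M * (1 + 2 ^ n)) * (2 * (2 ^ i * r)) ^ n) := by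
  set β := ballMean b c r
  set β' := ballMean b c (2 ^ i * r)
  have hbm := aemeasurable_of_locallyIntegrable hb
  have hd : |β' - β| ≤ i * (M * (1 + 2 ^ n)) := abs_ballMean_sub_pow_le hb hM hosc c hr i
  calc ∫⁻ x in closedBall c (2 ^ i * r), ENNReal.ofReal |b x - β|
      ≤ ∫⁻ x in cube c (2 * (2 ^ i * r)), ENNReal.ofReal |b x - β| :=
        lintegral_mono_set (closedBall_subset_cube _ _)
    _ ≤ ∫⁻ x in cube c (2 * (2 ^ i * r)),
          (ENNReal.ofReal (i * (M * (1 + 2 ^ n))) + ENNReal.ofReal |b x - β'|) := by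
        refine lintegral_mono fun x => ?_
        rw [← ENNReal.ofReal_add (by positivity) (abs_nonneg _)]
        refine ENNReal.ofReal_le_ofReal ?_
        linarith [abs_sub_le (b x) β' β]
    _ ≤ ENNReal.ofReal (i * (M * (1 + 2 ^ n)) * (2 * (2 ^ i * r)) ^ n) +
          ENNReal.ofReal (M * (2 * (2 ^ i * r)) ^ n) := by
        rw [lintegral_add_left measurable_const, setLIntegral_const, volume_cube _ (by positivity),
          ← ENNReal.ofReal_mul (by positivity)]
        gcongr
        exact lintegral_cube_le hb hosc c (by positivity)
    _ ≤ _ := by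
        rw [← ENNReal.ofReal_add (by positivity) (by positivity)]
        refine ENNReal.ofReal_le_ofReal ?_
        have h2 : (0:ℝ) ≤ M * (2 * (2 ^ i * r)) ^ n * 2 ^ n := by positivity
        nlinarith

/-- Chebyshev's inequality as a criterion for `SmallOsc`. -/
lemma smallOsc_of_lintegral_le {n : ℕ} {G : Rn n → ℝ} (hG : AEMeasurable G) {A : ℝ} (hA : 0 < A)
    {x : Rn n} {r c : ℝ} (h : ∫⁻ y in closedBall x r, ENNReal.ofReal |G y - c| ≤
      ENNReal.ofReal A * (ENNReal.ofReal (jsEps n) * volume (closedBall x r))) :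
    SmallOsc G A x r c := by
  have hm : AEMeasurable (fun y => ENNReal.ofReal |G y - c|) (volume.restrict (closedBall x r)) :=
    (hG.sub_const _).abs.ennreal_ofReal.restrict
  have h1 := mul_meas_ge_le_lintegral₀ hm (ENNReal.ofReal A)
  have hA0 : ENNReal.ofReal A ≠ 0 := by simpa using hA
  have h2 := (ENNReal.mul_le_mul_iff_right hA0 ENNReal.ofReal_ne_top).1 (h1.trans h)
  refine le_trans ?_ h2
  rw [Measure.restrict_apply' measurableSet_closedBall]
  refine measure_mono fun y hy => ⟨?_, hy.1⟩
  exact ENNReal.ofReal_le_ofReal hy.2.le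

/-- Bounds for `b - b_B` with `b` in BMO: logarithmic growth of the `L¹` means, and a local `L²`
bound. -/
theorem exists_bmo_const {n : ℕ} (hn : 1 ≤ n) {M : ℝ} (hM : 0 ≤ M) : ∃ C : ℝ≥0,
    ∀ b : Rn n → ℝ, LocallyIntegrable b volume → OscBound b M → ∀ (c : Rn n) (r : ℝ), 0 < r →
      (∀ i : ℕ, ∫⁻ x in closedBall c (2 ^ (i + 1) * r), ENNReal.ofReal |b x - ballMean b c r| ≤
        ENNReal.ofReal (1 + i) * C * ENNReal.ofReal ((2 ^ i * r) ^ n)) ∧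
      (∫⁻ x in closedBall c r, ENNReal.ofReal |b x - ballMean b c r| ≤
        C * ENNReal.ofReal (r ^ n)) ∧
      (∫⁻ x in closedBall c r, ENNReal.ofReal ((b x - ballMean b c r) ^ 2) ≤
        C * ENNReal.ofReal (r ^ n)) := by
  obtain ⟨J, hJ⟩ := johnStromberg_sq hn
  set V := (unitVol n).toReal with hV
  have hV0 : 0 < V := ENNReal.toReal_pos (unitVol_ne_zero n) (unitVol_ne_top n)
  have hVe : unitVol n = ENNReal.ofReal V := (ENNReal.ofReal_toReal (unitVol_ne_top n)).symm
  have hε := jsEps_pos n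
  set A : ℝ := (M + 1) * (1 + 2 ^ n) * 2 ^ n / (jsEps n * V) with hAdef
  have hA : 0 < A := by positivity
  set C₁ : ℝ := 2 * (M * (1 + 2 ^ n)) * 4 ^ n with hC₁
  set C₂ : ℝ := J * A ^ 2 * V with hC₂
  refine ⟨(C₁ + C₂).toNNReal, fun b hb hosc c r hr => ?_⟩
  have hbm := aemeasurable_of_locallyIntegrable hb
  have hC : ((C₁ + C₂).toNNReal : ℝ≥0∞) = ENNReal.ofReal (C₁ + C₂) := rfl
  have hC1 : 0 ≤ C₁ := by positivity
  have hC2 : 0 ≤ C₂ := by positivity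
  have hbase : ∀ (x : Rn n) (s : ℝ), 0 < s →
      ∫⁻ y in closedBall x s, ENNReal.ofReal |b y - ballMean b x s| ≤
        ENNReal.ofReal (M * (1 + 2 ^ n) * (2 * s) ^ n) := fun x s hs => by
    have := lintegral_bmo_le hb hM hosc x hs 0
    simpa using this
  have hsmall : ∀ (x : Rn n) (s : ℝ), 0 < s → SmallOsc b A x s (ballMean b x s) := by
    intro x s hs
    refine smallOsc_of_lintegral_le hbm hA ((hbase x s hs).trans ?_)
    rw [volume_closedBall_Rn _ hs.le, hVe, ← ENNReal.ofReal_mul (by positivity),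
      ← ENNReal.ofReal_mul (by positivity), ← ENNReal.ofReal_mul (by positivity)]
    refine ENNReal.ofReal_le_ofReal ?_
    have : A * (jsEps n * (s ^ n * V)) = (M + 1) * (1 + 2 ^ n) * (2 * s) ^ n := by
      rw [hAdef, mul_pow]
      field_simp
    rw [this]
    gcongr
    linarith
  refine ⟨fun i => ?_, ?_, ?_⟩
  · refine (lintegral_bmo_le hb hM hosc c hr (i + 1)).trans ?_
    rw [hC, ← ENNReal.ofReal_mul (by positivity), ← ENNReal.ofReal_mul (by positivity)]
    refine ENNReal.ofReal_le_ofReal ?_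
    calc (1 + ((i + 1 : ℕ) : ℝ)) * (M * (1 + 2 ^ n)) * (2 * (2 ^ (i + 1) * r)) ^ n
        ≤ (2 * (1 + i)) * (M * (1 + 2 ^ n)) * (4 * (2 ^ i * r)) ^ n := by
          have h1 : (1 + ((i + 1 : ℕ) : ℝ)) ≤ 2 * (1 + i) := by
            push_cast; linarith [(Nat.cast_nonneg i : (0:ℝ) ≤ i)]
          have h2 : (2 * (2 ^ (i + 1) * r)) = (4 * (2 ^ i * r)) := by ring
          rw [h2]
          gcongr
      _ = (1 + i) * C₁ * (2 ^ i * r) ^ n := by rw [hC₁, mul_pow 4]; ring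
      _ ≤ _ := by gcongr; linarith
  · refine (hbase c r hr).trans ?_
    rw [hC, ← ENNReal.ofReal_mul (by positivity)]
    refine ENNReal.ofReal_le_ofReal ?_
    calc M * (1 + 2 ^ n) * (2 * r) ^ n = M * (1 + 2 ^ n) * 2 ^ n * r ^ n := by rw [mul_pow]; ring
      _ ≤ C₁ * r ^ n := by
        rw [hC₁]
        have h1 : (2:ℝ) ^ n ≤ 4 ^ n := by gcongr; norm_num
        have h2 : 0 ≤ M * (1 + 2 ^ n) := by positivity
        refine mul_le_mul_of_nonneg_right ?_ (by positivity)
        exact mul_le_mul (by linarith) h1 (by positivity) (by positivity)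
      _ ≤ _ := by gcongr; linarith
  · refine (hJ hbm hA (fun x s hs => ⟨_, hsmall x s hs⟩) c r _ hr (hsmall c r hr)).trans ?_
    rw [hC, volume_closedBall_Rn _ hr.le, hVe, ← ENNReal.ofReal_coe_nnreal,
      ← ENNReal.ofReal_mul (by positivity), ← ENNReal.ofReal_mul (by positivity),
      ← ENNReal.ofReal_mul (by positivity), ← ENNReal.ofReal_mul (by positivity)]
    refine ENNReal.ofReal_le_ofReal ?_
    calc (J : ℝ) * A ^ 2 * (r ^ n * V) = C₂ * r ^ n := by rw [hC₂]; ring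
      _ ≤ _ := by gcongr; linarith

/-- A bilinear Calderón-Zygmund operator whose kernel constant and weak-type constant are `1`,
with a modulus of continuity that is monotone and nonnegative on the whole line. -/
structure NormCZ {n : ℕ} (ω : ℝ → ℝ) (K : Rn n → Rn n → Rn n → ℝ)
    (T : (Rn n → ℝ) → (Rn n → ℝ) → Rn n → ℝ) : Prop where
  nonneg : ∀ t, 0 ≤ ω t
  mono : Monotone ω
  dini : diniSum ω ≠ ⊤
  kernel : IsCZKernel2 1 ω K
  meas : ∀ f g : Rn n → ℝ, Integrable f → Integrable g → Measurable (T f g)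
  bilin : Bilin2 T
  rep : KernelRep2 K T
  weak : ∀ f g : Rn n → ℝ, Integrable f → Integrable g → ∀ lam : ℝ, 0 < lam →
    volume {x | lam < |T f g x|} ≤ ENNReal.ofReal ((l1norm f * l1norm g / lam) ^ ((1:ℝ)/2))

namespace NormCZ

variable {n : ℕ} {ω : ℝ → ℝ} {K : Rn n → Rn n → Rn n → ℝ}
  {T : (Rn n → ℝ) → (Rn n → ℝ) → Rn n → ℝ}

/-- Exchanging the two entries. -/
lemma swap (h : NormCZ ω K T) : NormCZ ω (fun x y₁ y₂ => K x y₂ y₁) (fun f g => T g f) where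
  nonneg := h.nonneg
  mono := h.mono
  dini := h.dini
  kernel := by
    obtain ⟨h1, h2, h3, h4⟩ := h.kernel
    have hne : ∀ {x y₁ y₂ : Rn n}, ¬(x = y₁ ∧ y₁ = y₂) → ¬(x = y₂ ∧ y₂ = y₁) := by
      rintro x y₁ y₂ hh ⟨rfl, rfl⟩
      exact hh ⟨rfl, rfl⟩
    refine ⟨fun x y₁ y₂ hd => ?_, fun x x' y₁ y₂ hd hx => ?_, fun x y₁ y₁' y₂ hd hx => ?_,
      fun x y₁ y₂ y₂' hd hx => ?_⟩
    · rw [add_comm]; exact h1 x y₂ y₁ (hne hd)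
    · rw [add_comm ‖x - y₁‖]; rw [max_comm] at hx; exact h2 x x' y₂ y₁ (hne hd) hx
    · rw [add_comm ‖x - y₁‖]; rw [max_comm] at hx; exact h4 x y₂ y₁ y₁' (hne hd) hx
    · rw [add_comm ‖x - y₁‖]; rw [max_comm] at hx; exact h3 x y₂ y₂' y₁ (hne hd) hx
  meas := fun f g hf hg => h.meas g f hg hf
  bilin := ⟨fun f f' g hf hf' hg x => h.bilin.2.2.1 g f f' hg hf hf' x,
    fun r f g hf hg x => h.bilin.2.2.2 r g f hg hf x,
    fun f g g' hf hg hg' x => h.bilin.1 g g' f hg hg' hf x,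
    fun r f g hf hg x => h.bilin.2.1 r g f hg hf x⟩
  rep := fun f g hf hg hfs hgs => by
    filter_upwards [h.rep g f hg hf hgs hfs] with x hx hmem
    rw [hx (by rwa [inter_comm]), Measure.volume_eq_prod, ← integral_prod_swap]
    refine integral_congr_ae (ae_of_all _ fun p => ?_)
    simp only [Prod.fst_swap, Prod.snd_swap]
    ring
  weak := fun f g hf hg lam hlam => by
    rw [mul_comm (l1norm f)]
    exact h.weak g f hg hf lam hlam

lemma exists_modulus (h : NormCZ ω K T) {ε : ℝ} (hε : 0 < ε) :
    ∃ δ : ℝ, 0 < δ ∧ ∀ t, t ≤ δ → ω t ≤ ε := by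
  obtain ⟨δ, hδ, h1⟩ := exists_modulus_le (fun s t _ hst => h.mono hst) h.dini hε
  exact ⟨δ, hδ, fun t ht => (h.mono ht).trans (h1 δ hδ le_rfl)⟩

lemma continuousAt_kernel (h : NormCZ ω K T) {x : Rn n} {p : Rn n × Rn n} (hp : p ≠ (x, x)) :
    ContinuousAt (fun p : Rn n × Rn n => K x p.1 p.2) p := by
  obtain ⟨y₁, y₂⟩ := p
  set s := ‖x - y₁‖ + ‖x - y₂‖ with hs
  have hs0 : 0 < s := by
    by_contra hcon
    have h1 : ‖x - y₁‖ = 0 := by linarith [norm_nonneg (x - y₁), norm_nonneg (x - y₂)]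
    have h2 : ‖x - y₂‖ = 0 := by linarith [norm_nonneg (x - y₁), norm_nonneg (x - y₂)]
    rw [norm_eq_zero, sub_eq_zero] at h1 h2
    exact hp (by rw [← h1, ← h2])
  rw [Metric.continuousAt_iff]
  intro ε hε
  set B : ℝ := 1 / s ^ (2 * n) + 1 / (s / 2) ^ (2 * n) with hB
  have hB0 : 0 < B := by positivity
  obtain ⟨δ, hδ, hω⟩ := h.exists_modulus (show 0 < ε / (2 * B) by positivity)
  refine ⟨min (s / 8) (δ * s / 2), by positivity, fun {p'} hp' => ?_⟩
  obtain ⟨z₁, z₂⟩ := p'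
  have hd := lt_min_iff.1 hp'
  have hd1 : ‖y₁ - z₁‖ ≤ dist (z₁, z₂) (y₁, y₂) := by
    rw [← dist_eq_norm, dist_comm, Prod.dist_eq]; exact le_max_left _ _
  have hd2 : ‖y₂ - z₂‖ ≤ dist (z₁, z₂) (y₁, y₂) := by
    rw [← dist_eq_norm, dist_comm, Prod.dist_eq]; exact le_max_right _ _
  have hm1 : s / 2 ≤ max ‖x - y₁‖ ‖x - y₂‖ := by
    have := le_max_left ‖x - y₁‖ ‖x - y₂‖
    have := le_max_right ‖x - y₁‖ ‖x - y₂‖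
    linarith
  set s' := ‖x - z₁‖ + ‖x - y₂‖ with hs'
  have hss : s / 2 ≤ s' := by
    have : ‖x - y₁‖ ≤ ‖x - z₁‖ + ‖y₁ - z₁‖ := by
      have := norm_sub_le_norm_sub_add_norm_sub x z₁ y₁
      rwa [norm_sub_rev z₁] at this
    linarith
  have hs'0 : 0 < s' := by linarith
  have hm2 : s' / 2 ≤ max ‖x - z₁‖ ‖x - y₂‖ := by
    have := le_max_left ‖x - z₁‖ ‖x - y₂‖
    have := le_max_right ‖x - z₁‖ ‖x - y₂‖
    linarith
  have hne1 : ¬(x = y₁ ∧ y₁ = y₂) := by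
    rintro ⟨rfl, rfl⟩; simp [hs] at hs0
  have hne2 : ¬(x = z₁ ∧ z₁ = y₂) := by
    rintro ⟨rfl, rfl⟩; simp [hs'] at hs'0
  have k1 := h.kernel.2.2.1 x y₁ z₁ y₂ hne1 (by linarith)
  have k2 := h.kernel.2.2.2 x z₁ y₂ z₂ hne2 (by linarith)
  have w1 : ω (‖y₁ - z₁‖ / s) ≤ ε / (2 * B) := by
    refine hω _ ?_
    rw [div_le_iff₀ hs0]
    have : 0 < δ * s := by positivity
    linarith
  have w2 : ω (‖y₂ - z₂‖ / s') ≤ ε / (2 * B) := by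
    refine hω _ ?_
    rw [div_le_iff₀ hs'0]
    have : δ * (s / 2) ≤ δ * s' := by gcongr
    linarith
  have e1 : |K x y₁ y₂ - K x z₁ y₂| ≤ 1 / s ^ (2 * n) * (ε / (2 * B)) :=
    k1.trans (by gcongr)
  have e2 : |K x z₁ y₂ - K x z₁ z₂| ≤ 1 / (s / 2) ^ (2 * n) * (ε / (2 * B)) :=
    k2.trans (by
      have := h.nonneg (‖y₂ - z₂‖ / s')
      gcongr)
  rw [dist_comm, Real.dist_eq]
  calc |K x y₁ y₂ - K x z₁ z₂| ≤ |K x y₁ y₂ - K x z₁ y₂| + |K x z₁ y₂ - K x z₁ z₂| :=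
        abs_sub_le _ _ _
    _ ≤ B * (ε / (2 * B)) := by rw [hB, add_mul]; exact add_le_add e1 e2
    _ < ε := by
      have : B * (ε / (2 * B)) = ε / 2 := by field_simp
      rw [this]; linarith

lemma measurable_kernel (h : NormCZ ω K T) (x : Rn n) :
    Measurable fun p : Rn n × Rn n => K x p.1 p.2 :=
  measurable_of_continuousOn_compl_singleton (x, x) fun _ hp =>
    (h.continuousAt_kernel hp).continuousWithinAt

lemma integrable_kernel (h : NormCZ ω K T) {F G : Rn n → ℝ} (hF : Integrable F)
    (hG : Integrable G) {x : Rn n} {δ : ℝ} (hδ : 0 < δ)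
    (hfar : ∀ y₁ y₂, F y₁ ≠ 0 → G y₂ ≠ 0 → δ ≤ ‖x - y₁‖ + ‖x - y₂‖) :
    Integrable fun p : Rn n × Rn n => K x p.1 p.2 * F p.1 * G p.2 := by
  have hFG : Integrable (fun p : Rn n × Rn n => F p.1 * G p.2) := hF.mul_prod hG
  simp only [mul_assoc]
  refine (hFG.norm.const_mul (1 / δ ^ (2 * n))).mono'
    ((h.measurable_kernel x).aestronglyMeasurable.mul hFG.aestronglyMeasurable)
    (ae_of_all _ fun p => ?_)
  rw [norm_mul]
  by_cases h0 : F p.1 * G p.2 = 0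
  · simp [h0]
  · refine mul_le_mul_of_nonneg_right ?_ (norm_nonneg _)
    have hd := hfar p.1 p.2 (left_ne_zero_of_mul h0) (right_ne_zero_of_mul h0)
    refine (h.kernel.1 x p.1 p.2 ?_).trans (by gcongr)
    rintro ⟨h1, h2⟩
    rw [← h2, ← h1] at hd
    simp at hd
    linarith

/-- Decay of `T(f,g)` away from the support of a mean-zero function `f`. -/
theorem cancel (h : NormCZ ω K T) {f g : Rn n → ℝ} (hf : Integrable f) (hg : Integrable g)
    (hgs : HasCompactSupport g) {c : Rn n} {R : ℝ} (hR : 0 < R)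
    (hfs : ∀ y, y ∉ closedBall c (R / 2) → f y = 0) (hf0 : ∫ y, f y = 0) :
    ∀ᵐ x, R ≤ ‖x - c‖ → ENNReal.ofReal |T f g x| ≤
      ENNReal.ofReal (ω (R / ‖x - c‖)) * (∫⁻ y, ENNReal.ofReal |f y|) *
        ∫⁻ y, ENNReal.ofReal |g y| * ENNReal.ofReal (1 / (‖x - c‖ + ‖x - y‖) ^ (2 * n)) := by
  have hfc : HasCompactSupport f := HasCompactSupport.intro (isCompact_closedBall _ _) hfs
  have hts : tsupport f ⊆ closedBall c (R / 2) := by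
    refine closure_minimal (fun y hy => ?_) isClosed_closedBall
    by_contra hcon
    exact hy (hfs y hcon)
  filter_upwards [h.rep f g hf hg hfc hgs] with x hx hxR
  have hxs : x ∉ tsupport f ∩ tsupport g := by
    rintro ⟨h1, -⟩
    have := hts h1
    rw [mem_closedBall, dist_eq_norm] at this
    linarith
  have hy1 : ∀ y₁, f y₁ ≠ 0 → ‖y₁ - c‖ ≤ R / 2 := by
    intro y₁ h1
    by_contra hcon
    exact h1 (hfs _ (by rwa [mem_closedBall, dist_eq_norm]))
  have hc0 : 0 < ‖x - c‖ := hR.trans_le hxR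
  have int1 : Integrable fun p : Rn n × Rn n => K x p.1 p.2 * f p.1 * g p.2 := by
    refine h.integrable_kernel hf hg (x := x) (half_pos hR) fun y₁ y₂ h1 _ => ?_
    have := norm_sub_le_norm_sub_add_norm_sub x y₁ c
    linarith [hy1 y₁ h1, norm_nonneg (x - y₂)]
  have int2 : Integrable fun y : Rn n => K x c y * g y := by
    have hm : Measurable fun y : Rn n => K x c y :=
      (h.measurable_kernel x).comp measurable_prodMk_left
    refine hg.bdd_mul (c := 1 / ‖x - c‖ ^ (2 * n)) hm.aestronglyMeasurable
      (ae_of_all _ fun y => ?_)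
    refine (h.kernel.1 x c y ?_).trans ?_
    · rintro ⟨rfl, -⟩; simp at hc0
    · gcongr; linarith [norm_nonneg (x - y)]
  have int2' : Integrable fun p : Rn n × Rn n => f p.1 * (K x c p.2 * g p.2) := hf.mul_prod int2
  have hzero : ∫ p : Rn n × Rn n, f p.1 * (K x c p.2 * g p.2) = 0 := by
    rw [Measure.volume_eq_prod, integral_prod_mul f fun y => K x c y * g y, hf0, zero_mul]
  have hT : T f g x = ∫ p : Rn n × Rn n, (K x p.1 p.2 - K x c p.2) * f p.1 * g p.2 := by
    rw [hx hxs, ← sub_zero (∫ p : Rn n × Rn n, K x p.1 p.2 * f p.1 * g p.2), ← hzero,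
      ← integral_sub int1 int2']
    congr 1
    ext p
    ring
  rw [hT, ← Real.enorm_eq_ofReal_abs]
  refine (enorm_integral_le_lintegral_enorm _).trans ?_
  calc ∫⁻ p : Rn n × Rn n, ‖(K x p.1 p.2 - K x c p.2) * f p.1 * g p.2‖ₑ
      ≤ ∫⁻ p : Rn n × Rn n, ENNReal.ofReal (ω (R / ‖x - c‖)) * (ENNReal.ofReal |f p.1| *
          (ENNReal.ofReal |g p.2| *
            ENNReal.ofReal (1 / (‖x - c‖ + ‖x - p.2‖) ^ (2 * n)))) := by
        refine lintegral_mono fun p => ?_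
        rw [Real.enorm_eq_ofReal_abs]
        by_cases hp : f p.1 = 0
        · simp [hp]
        have hp1 := hy1 _ hp
        have k := h.kernel.2.2.1 x c p.1 p.2 (by rintro ⟨rfl, -⟩; simp at hc0) (by
          rw [norm_sub_rev]
          linarith [le_max_left ‖x - c‖ ‖x - p.2‖])
        rw [← ENNReal.ofReal_mul (abs_nonneg _), ← ENNReal.ofReal_mul (abs_nonneg _),
          ← ENNReal.ofReal_mul (h.nonneg _), abs_mul, abs_mul, abs_sub_comm]
        refine ENNReal.ofReal_le_ofReal ?_
        have hω : ω (‖c - p.1‖ / (‖x - c‖ + ‖x - p.2‖)) ≤ ω (R / ‖x - c‖) := by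
          refine h.mono ?_
          rw [norm_sub_rev]
          gcongr
          · linarith
          · linarith [norm_nonneg (x - p.2)]
        calc |K x c p.2 - K x p.1 p.2| * |f p.1| * |g p.2|
            ≤ (1 / (‖x - c‖ + ‖x - p.2‖) ^ (2 * n) * ω (R / ‖x - c‖)) * |f p.1| * |g p.2| := by
              gcongr
              exact k.trans (by gcongr)
          _ = _ := by ring
    _ = _ := by
        rw [lintegral_const_mul' _ _ ENNReal.ofReal_ne_top, Measure.volume_eq_prod,
          lintegral_prod_mul (f := fun y => ENNReal.ofReal |f y|)
            (g := fun y => ENNReal.ofReal |g y| *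
              ENNReal.ofReal (1 / (‖x - c‖ + ‖x - y‖) ^ (2 * n)))]
        · ring
        · exact hf.aestronglyMeasurable.aemeasurable.abs.ennreal_ofReal
        · refine hg.aestronglyMeasurable.aemeasurable.abs.ennreal_ofReal.mul ?_
          exact Measurable.aemeasurable (by fun_prop)

end NormCZ

lemma toReal_volume_closedBall {n : ℕ} (x : Rn n) {r : ℝ} (hr : 0 ≤ r) :
    (volume (closedBall x r)).toReal = r ^ n * (unitVol n).toReal := by
  rw [volume_closedBall_Rn x hr, ENNReal.toReal_mul, ENNReal.toReal_ofReal (by positivity)]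

lemma l1norm_le_of_bounded {n : ℕ} {f : Rn n → ℝ} (hf : Integrable f) {A : ℝ}
    (hA : ∀ᵐ y, |f y| ≤ A) {x : Rn n} {r : ℝ} (hr : 0 ≤ r)
    (hfs : ∀ y, y ∉ closedBall x r → f y = 0) :
    l1norm f ≤ A * (r ^ n * (unitVol n).toReal) := by
  have h1 : l1norm f = ∫ y in closedBall x r, |f y| :=
    (setIntegral_eq_integral_of_forall_compl_eq_zero fun y hy => by simp [hfs y hy]).symm
  rw [h1]
  calc ∫ y in closedBall x r, |f y| ≤ ∫ _ in closedBall x r, A :=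
        integral_mono_ae hf.abs.integrableOn (integrableOn_const (volume_closedBall_ne_top x r))
          (ae_restrict_of_ae hA)
    _ = _ := by
        rw [setIntegral_const, measureReal_def, toReal_volume_closedBall x hr, smul_eq_mul,
          mul_comm]

lemma lintegral_abs_eq_l1norm {n : ℕ} {f : Rn n → ℝ} (hf : Integrable f) :
    ∫⁻ y, ENNReal.ofReal |f y| = ENNReal.ofReal (l1norm f) :=
  (ofReal_integral_eq_lintegral_ofReal hf.abs (ae_of_all _ fun _ => abs_nonneg _)).symm

lemma SmallOsc.add_ae {n : ℕ} {G G₁ G₂ : Rn n → ℝ} {A₁ A₂ : ℝ} {x : Rn n} {r c : ℝ}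
    (h₁ : SmallOsc G₁ A₁ x r 0) (h₂ : ∀ᵐ y, y ∈ closedBall x r → |G₂ y - c| ≤ A₂)
    (hG : ∀ y, G y = G₁ y + G₂ y) : SmallOsc G (A₁ + A₂) x r c := by
  refine le_trans (measure_mono_ae ?_) h₁
  filter_upwards [h₂] with y hy hmem
  refine ⟨hmem.1, ?_⟩
  have h3 := hy hmem.1
  have h4 : A₁ + A₂ < |G y - c| := hmem.2
  rw [hG, show G₁ y + G₂ y - c = G₁ y + (G₂ y - c) by ring] at h4
  have := abs_add_le (G₁ y) (G₂ y - c)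
  rw [sub_zero]
  linarith

lemma abs_indicator_le_ae {n : ℕ} {f : Rn n → ℝ} {A : ℝ} (hA : ∀ᵐ y, |f y| ≤ A) (s : Set (Rn n)) :
    ∀ᵐ y, |s.indicator f y| ≤ A := by
  filter_upwards [hA] with y hy
  by_cases hs : y ∈ s
  · rwa [indicator_of_mem hs]
  · rw [indicator_of_notMem hs, abs_zero]
    exact (abs_nonneg _).trans hy

lemma tsupport_indicator_compl_closedBall {n : ℕ} (f : Rn n → ℝ) (x : Rn n) (r : ℝ) :
    tsupport ((closedBall x r)ᶜ.indicator f) ⊆ {y | r ≤ ‖x - y‖} := by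
  refine closure_minimal (fun y hy => ?_) (isClosed_le continuous_const (by fun_prop))
  have := mem_of_indicator_ne_zero hy
  rw [mem_compl_iff, mem_closedBall', dist_eq_norm, not_le] at this
  exact this.le

namespace NormCZ

variable {n : ℕ} {ω : ℝ → ℝ} {K : Rn n → Rn n → Rn n → ℝ}
  {T : (Rn n → ℝ) → (Rn n → ℝ) → Rn n → ℝ}

lemma map_add_left (h : NormCZ ω K T) {f₁ f₂ g : Rn n → ℝ} (hf₁ : Integrable f₁)
    (hf₂ : Integrable f₂) (hg : Integrable g) (x : Rn n) :
    T (f₁ + f₂) g x = T f₁ g x + T f₂ g x :=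
  h.bilin.1 f₁ f₂ g hf₁ hf₂ hg x

lemma map_add_right (h : NormCZ ω K T) {f g₁ g₂ : Rn n → ℝ} (hf : Integrable f)
    (hg₁ : Integrable g₁) (hg₂ : Integrable g₂) (x : Rn n) :
    T f (g₁ + g₂) x = T f g₁ x + T f g₂ x :=
  h.bilin.2.2.1 f g₁ g₂ hf hg₁ hg₂ x

/-- `T` applied to bounded functions supported in a common ball. -/
lemma smallOsc_local (h : NormCZ ω K T) {f g : Rn n → ℝ} (hf : Integrable f) (hg : Integrable g)
    (hf1 : ∀ᵐ y, |f y| ≤ 1) (hg1 : ∀ᵐ y, |g y| ≤ 1) {x : Rn n} {r : ℝ} (hr : 0 < r)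
    (hfs : ∀ y, y ∉ closedBall x (4 * r) → f y = 0)
    (hgs : ∀ y, y ∉ closedBall x (4 * r) → g y = 0) :
    SmallOsc (T f g) ((4 ^ n / jsEps n) ^ 2) x r 0 := by
  have hε := jsEps_pos n
  have hF := l1norm_le_of_bounded hf hf1 (by positivity) hfs
  have hG := l1norm_le_of_bounded hg hg1 (by positivity) hgs
  have hF0 : 0 ≤ l1norm f := integral_nonneg fun _ => abs_nonneg _
  have hG0 : 0 ≤ l1norm g := integral_nonneg fun _ => abs_nonneg _
  set V := (unitVol n).toReal
  calc volume {y | y ∈ closedBall x r ∧ (4 ^ n / jsEps n) ^ 2 < |T f g y - 0|}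
      ≤ volume {y | (4 ^ n / jsEps n) ^ 2 < |T f g y|} :=
        measure_mono fun y hy => by simpa using hy.2
    _ ≤ ENNReal.ofReal ((l1norm f * l1norm g / (4 ^ n / jsEps n) ^ 2) ^ ((1:ℝ)/2)) :=
        h.weak f g hf hg _ (by positivity)
    _ ≤ ENNReal.ofReal (((jsEps n * (r ^ n * V)) ^ 2) ^ ((1:ℝ)/2)) := by
        refine ENNReal.ofReal_le_ofReal (Real.rpow_le_rpow (by positivity) ?_ (by norm_num))
        rw [div_le_iff₀ (by positivity)]
        calc l1norm f * l1norm g ≤ (1 * ((4 * r) ^ n * V)) * (1 * ((4 * r) ^ n * V)) := by gcongr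
          _ = _ := by rw [mul_pow 4 r]; field_simp
    _ = _ := by
        rw [← Real.sqrt_eq_rpow, Real.sqrt_sq (by positivity), ← toReal_volume_closedBall x hr.le,
          ENNReal.ofReal_mul hε.le, ENNReal.ofReal_toReal (volume_closedBall_ne_top x r)]

/-- Size of `T(f,g)` on a ball around the support of `f`. -/
theorem smallOsc_size (hn : 1 ≤ n) (h : NormCZ ω K T) {f g : Rn n → ℝ} (hf : Integrable f)
    (hg : Integrable g) (hgc : HasCompactSupport g)
    (hf1 : ∀ᵐ y, |f y| ≤ 1) (hg1 : ∀ᵐ y, |g y| ≤ 1) {c : Rn n} {R : ℝ} (hR : 0 < R)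
    (hfs : ∀ y, y ∉ closedBall c (R / 2) → f y = 0) :
    SmallOsc (T f g)
      ((4 ^ n / jsEps n) ^ 2 + 4 ^ n * 2 ^ (n + 1) * (unitVol n).toReal ^ 2) c R 0 := by
  set V := (unitVol n).toReal with hV
  have hVe : unitVol n = ENNReal.ofReal V := (ENNReal.ofReal_toReal (unitVol_ne_top n)).symm
  have hfs' : ∀ s, R / 2 ≤ s → ∀ y, y ∉ closedBall c s → f y = 0 := fun s hs y hy =>
    hfs y fun hy' => hy (closedBall_subset_closedBall hs hy')
  set g₁ := (closedBall c (4 * R)).indicator g with hg₁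
  set g₂ := (closedBall c (4 * R))ᶜ.indicator g with hg₂
  have ig₁ : Integrable g₁ := hg.indicator measurableSet_closedBall
  have ig₂ : Integrable g₂ := hg.indicator measurableSet_closedBall.compl
  have hsplit : g = g₁ + g₂ := (indicator_self_add_compl _ g).symm
  have hg₂c : HasCompactSupport g₂ := hgc.mono (by
    rw [hg₂, Set.support_indicator]; exact inter_subset_right)
  have hfc : HasCompactSupport f := HasCompactSupport.intro (isCompact_closedBall _ _) hfs
  have loc := h.smallOsc_local hf ig₁ hf1 (abs_indicator_le_ae hg1 _) hR
    (hfs' _ (by linarith)) (fun y hy => indicator_of_notMem hy g)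
  refine loc.add_ae (G₂ := T f g₂) ?_ fun y => by rw [← h.map_add_right hf ig₁ ig₂, ← hsplit]
  filter_upwards [h.rep f g₂ hf ig₂ hfc hg₂c] with x hx hxR
  rw [mem_closedBall', dist_eq_norm] at hxR
  have hxs : x ∉ tsupport f ∩ tsupport g₂ := by
    rintro ⟨-, h1⟩
    have := tsupport_indicator_compl_closedBall g c (4 * R) h1
    simp only [mem_ofPred_eq] at this
    linarith
  rw [hx hxs, sub_zero]
  refine (ENNReal.ofReal_le_ofReal_iff (by positivity)).1 ?_
  rw [← Real.enorm_eq_ofReal_abs]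
  have hpoisson : ∫⁻ y, ENNReal.ofReal (1 / (R + ‖x - y‖) ^ (2 * n)) ≤
      unitVol n * ENNReal.ofReal (2 ^ (n + 1) / R ^ n) := by
    simpa using lintegral_poisson hn (F := fun _ => 1) (x := x) hR (a := 1)
      (fun s _ => by rw [setLIntegral_const])
  have hfl : ∫⁻ y, ENNReal.ofReal |f y| ≤ ENNReal.ofReal (R ^ n * V) := by
    rw [lintegral_abs_eq_l1norm hf]
    refine ENNReal.ofReal_le_ofReal ?_
    simpa using l1norm_le_of_bounded hf hf1 hR.le (hfs' R (by linarith))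
  calc ‖∫ p : Rn n × Rn n, K x p.1 p.2 * f p.1 * g₂ p.2‖ₑ
      ≤ ∫⁻ p : Rn n × Rn n, ‖K x p.1 p.2 * f p.1 * g₂ p.2‖ₑ := enorm_integral_le_lintegral_enorm _
    _ ≤ ∫⁻ p : Rn n × Rn n, ENNReal.ofReal (4 ^ n) * (ENNReal.ofReal |f p.1| *
          ENNReal.ofReal (1 / (R + ‖x - p.2‖) ^ (2 * n))) := by
        refine lintegral_mono_ae ?_
        have hg₂1 : ∀ᵐ p : Rn n × Rn n, |g₂ p.2| ≤ 1 :=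
          Measure.quasiMeasurePreserving_snd.ae (abs_indicator_le_ae hg1 _)
        filter_upwards [hg₂1] with p hp
        rw [Real.enorm_eq_ofReal_abs]
        by_cases hp2 : g₂ p.2 = 0
        · simp [hp2]
        have hfar : 4 * R ≤ ‖c - p.2‖ :=
          tsupport_indicator_compl_closedBall g c (4 * R) (subset_tsupport _ hp2)
        have hxp : 3 * R ≤ ‖x - p.2‖ := by
          have := norm_sub_le_norm_sub_add_norm_sub c x p.2
          linarith
        rw [← ENNReal.ofReal_mul (abs_nonneg _), ← ENNReal.ofReal_mul (by positivity)]
        refine ENNReal.ofReal_le_ofReal ?_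
        have k := h.kernel.1 x p.1 p.2 (by
          rintro ⟨h1, h2⟩
          rw [← h2, ← h1, sub_self, norm_zero] at hxp
          linarith)
        rw [abs_mul, abs_mul]
        have k2 : |K x p.1 p.2| ≤ 4 ^ n * (1 / (R + ‖x - p.2‖) ^ (2 * n)) := by
          refine k.trans ?_
          calc (1:ℝ) / (‖x - p.1‖ + ‖x - p.2‖) ^ (2 * n)
              ≤ 1 / ((R + ‖x - p.2‖) / 2) ^ (2 * n) := by
                gcongr
                linarith [norm_nonneg (x - p.1)]
            _ = _ := by
                rw [div_pow, pow_mul 2 2 n, one_div_div, mul_one_div]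
                norm_num
        calc |K x p.1 p.2| * |f p.1| * |g₂ p.2|
            ≤ (4 ^ n * (1 / (R + ‖x - p.2‖) ^ (2 * n))) * |f p.1| * 1 := by gcongr
          _ = _ := by ring
    _ = ENNReal.ofReal (4 ^ n) * ((∫⁻ y, ENNReal.ofReal |f y|) *
          ∫⁻ y, ENNReal.ofReal (1 / (R + ‖x - y‖) ^ (2 * n))) := by
        rw [lintegral_const_mul' _ _ ENNReal.ofReal_ne_top, Measure.volume_eq_prod,
          lintegral_prod_mul (f := fun y => ENNReal.ofReal |f y|)
            (g := fun y => ENNReal.ofReal (1 / (R + ‖x - y‖) ^ (2 * n)))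
            hf.aestronglyMeasurable.aemeasurable.abs.ennreal_ofReal
            (Measurable.aemeasurable (by fun_prop))]
    _ ≤ ENNReal.ofReal (4 ^ n) * (ENNReal.ofReal (R ^ n * V) *
          (unitVol n * ENNReal.ofReal (2 ^ (n + 1) / R ^ n))) := by gcongr
    _ = _ := by
        rw [hVe, ← ENNReal.ofReal_mul (by positivity), ← ENNReal.ofReal_mul (by positivity),
          ← ENNReal.ofReal_mul (by positivity)]
        congr 1
        field_simp

/-- `T(f,g)` is nearly constant on a ball away from which one of the entries lives. -/
lemma ae_abs_sub_le_of_far (h : NormCZ ω K T) {f g : Rn n → ℝ} (hf : Integrable f)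
    (hg : Integrable g) (hfc : HasCompactSupport f) (hgc : HasCompactSupport g)
    (hf1 : ∀ᵐ y, |f y| ≤ 1) (hg1 : ∀ᵐ y, |g y| ≤ 1) {x : Rn n} {r : ℝ} (hr : 0 < r)
    (hfar : ∀ y₁ ∈ tsupport f, ∀ y₂ ∈ tsupport g, 4 * r ≤ max ‖x - y₁‖ ‖x - y₂‖) :
    ∃ c, ∀ᵐ y, y ∈ closedBall x r → |T f g y - c| ≤
      (ENNReal.ofReal (4 ^ n) * unitVol n ^ 2 * diniSum ω).toReal := by
  have hfin : ENNReal.ofReal (4 ^ n) * unitVol n ^ 2 * diniSum ω ≠ ⊤ :=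
    ENNReal.mul_ne_top (ENNReal.mul_ne_top ENNReal.ofReal_ne_top
      (ENNReal.pow_ne_top (unitVol_ne_top n))) h.dini
  refine ⟨∫ p : Rn n × Rn n, K x p.1 p.2 * f p.1 * g p.2, ?_⟩
  filter_upwards [h.rep f g hf hg hfc hgc] with y hy hyr
  rw [mem_closedBall', dist_eq_norm] at hyr
  have hys : y ∉ tsupport f ∩ tsupport g := by
    rintro ⟨h1, h2⟩
    have := hfar y h1 y h2
    rw [max_self] at this
    linarith
  have hmaxle : ∀ a b : ℝ, 0 ≤ a → 0 ≤ b → max a b ≤ a + b := fun a b ha hb =>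
    max_le (by linarith) (by linarith)
  have hx : ∀ y₁ y₂, f y₁ ≠ 0 → g y₂ ≠ 0 → 4 * r ≤ max ‖x - y₁‖ ‖x - y₂‖ :=
    fun y₁ y₂ h1 h2 => hfar y₁ (subset_tsupport _ h1) y₂ (subset_tsupport _ h2)
  have i1 := h.integrable_kernel hf hg (x := x) (δ := 4 * r) (by positivity) fun y₁ y₂ h1 h2 =>
    (hx y₁ y₂ h1 h2).trans (hmaxle _ _ (norm_nonneg _) (norm_nonneg _))
  have i2 := h.integrable_kernel hf hg (x := y) (δ := r) (by positivity) fun y₁ y₂ h1 h2 => by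
    have h3 := hx y₁ y₂ h1 h2
    have h4 := norm_sub_le_norm_sub_add_norm_sub x y y₁
    have h5 := norm_sub_le_norm_sub_add_norm_sub x y y₂
    have h6 : max ‖x - y₁‖ ‖x - y₂‖ ≤ r + (‖y - y₁‖ + ‖y - y₂‖) :=
      max_le (by linarith [norm_nonneg (y - y₂)]) (by linarith [norm_nonneg (y - y₁)])
    linarith
  rw [hy hys, ← integral_sub i2 i1]
  refine (ENNReal.ofReal_le_iff_le_toReal hfin).1 ?_
  rw [← Real.enorm_eq_ofReal_abs]
  refine (enorm_integral_le_lintegral_enorm _).trans ?_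
  refine le_trans ?_ (lintegral_far_prod x (R := 4 * r) (by positivity) h.nonneg h.mono)
  have hS : MeasurableSet {p : Rn n × Rn n | 4 * r ≤ max ‖x - p.1‖ ‖x - p.2‖} :=
    measurableSet_le measurable_const (by fun_prop)
  rw [← lintegral_indicator hS]
  refine lintegral_mono_ae ?_
  have hf1' : ∀ᵐ p : Rn n × Rn n, |f p.1| ≤ 1 := Measure.quasiMeasurePreserving_fst.ae hf1
  have hg1' : ∀ᵐ p : Rn n × Rn n, |g p.2| ≤ 1 := Measure.quasiMeasurePreserving_snd.ae hg1
  filter_upwards [hf1', hg1'] with p hp1 hp2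
  rw [← sub_mul, ← sub_mul, Real.enorm_eq_ofReal_abs]
  by_cases h1 : f p.1 = 0
  · simp [h1]
  by_cases h2 : g p.2 = 0
  · simp [h2]
  have h3 := hx p.1 p.2 h1 h2
  rw [indicator_of_mem (by exact h3)]
  refine ENNReal.ofReal_le_ofReal ?_
  set ρ := max ‖x - p.1‖ ‖x - p.2‖ with hρ
  have hρ0 : 0 < ρ := by linarith
  have hsum := hmaxle ‖x - p.1‖ ‖x - p.2‖ (norm_nonneg _) (norm_nonneg _)
  have k := h.kernel.2.1 x y p.1 p.2 (by
    rintro ⟨e1, e2⟩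
    rw [← e2, ← e1, sub_self, norm_zero, max_self] at hρ
    linarith) (by linarith)
  rw [abs_mul, abs_mul, abs_sub_comm]
  have hω : ω (‖x - y‖ / (‖x - p.1‖ + ‖x - p.2‖)) ≤ ω (4 * r / ρ) :=
    h.mono (by gcongr; linarith)
  calc |K x p.1 p.2 - K y p.1 p.2| * |f p.1| * |g p.2|
      ≤ (1 / ρ ^ (2 * n) * ω (4 * r / ρ)) * 1 * 1 := by
        have h5 := h.nonneg (‖x - y‖ / (‖x - p.1‖ + ‖x - p.2‖))
        have h6 := h.nonneg (4 * r / ρ)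
        gcongr
        exact k.trans (by gcongr)
    _ = _ := by ring

/-- `T(f,g)` has bounded oscillation in measure for bounded `f` and `g`. -/
theorem smallOsc_bounded (h : NormCZ ω K T) {f g : Rn n → ℝ} (hf : Integrable f)
    (hg : Integrable g) (hfc : HasCompactSupport f) (hgc : HasCompactSupport g)
    (hf1 : ∀ᵐ y, |f y| ≤ 1) (hg1 : ∀ᵐ y, |g y| ≤ 1) (x : Rn n) {r : ℝ} (hr : 0 < r) :
    ∃ c, SmallOsc (T f g) ((4 ^ n / jsEps n) ^ 2 +
      2 * (ENNReal.ofReal (4 ^ n) * unitVol n ^ 2 * diniSum ω).toReal) x r c := by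
  set B := closedBall x (4 * r) with hB
  have hBm : MeasurableSet B := measurableSet_closedBall
  have hc : ∀ (u : Rn n → ℝ), HasCompactSupport u → ∀ s : Set (Rn n),
      HasCompactSupport (s.indicator u) := fun u hu s => hu.mono (by
    rw [Set.support_indicator]; exact inter_subset_right)
  have fi := hf.indicator hBm
  have fo := hf.indicator hBm.compl
  have gi := hg.indicator hBm
  have go := hg.indicator hBm.compl
  have hfs : f = B.indicator f + Bᶜ.indicator f := (indicator_self_add_compl _ f).symm
  have hgs : g = B.indicator g + Bᶜ.indicator g := (indicator_self_add_compl _ g).symm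
  have loc := h.smallOsc_local fi gi (abs_indicator_le_ae hf1 _) (abs_indicator_le_ae hg1 _) hr
    (fun y hy => indicator_of_notMem hy f) (fun y hy => indicator_of_notMem hy g)
  obtain ⟨c₁, h₁⟩ := h.ae_abs_sub_le_of_far fi go (hc f hfc _) (hc g hgc _)
    (abs_indicator_le_ae hf1 _) (abs_indicator_le_ae hg1 _) hr fun y₁ _ y₂ hy₂ =>
      le_max_of_le_right (tsupport_indicator_compl_closedBall g x (4 * r) hy₂)
  obtain ⟨c₂, h₂⟩ := h.ae_abs_sub_le_of_far fo hg (hc f hfc _) hgc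
    (abs_indicator_le_ae hf1 _) hg1 hr fun y₁ hy₁ y₂ _ =>
      le_max_of_le_left (tsupport_indicator_compl_closedBall f x (4 * r) hy₁)
  refine ⟨c₁ + c₂, loc.add_ae
    (G₂ := fun y => T (B.indicator f) (Bᶜ.indicator g) y + T (Bᶜ.indicator f) g y) ?_ fun y => ?_⟩
  · filter_upwards [h₁, h₂] with y e1 e2 hy
    have e3 := abs_add_le (T (B.indicator f) (Bᶜ.indicator g) y - c₁)
      (T (Bᶜ.indicator f) g y - c₂)
    rw [add_sub_add_comm]
    linarith [e1 hy, e2 hy]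
  · rw [← add_assoc, ← h.map_add_right fi gi go, ← hgs, ← h.map_add_left fi fo hg, ← hfs]

end NormCZ

lemma SmallOsc.mono {n : ℕ} {G : Rn n → ℝ} {A A' : ℝ} {x : Rn n} {r c : ℝ}
    (h : SmallOsc G A x r c) (hA : A ≤ A') : SmallOsc G A' x r c := by
  refine le_trans (measure_mono ?_) h
  exact fun y hy => ⟨hy.1, hA.trans_lt hy.2⟩

/-- The `L¹` mean of `|b - b_B| |T(f,g)|` on a ball containing the support of `f`, for `b` in BMO and
bounded `f`, `g`. -/
theorem exists_near_const {n : ℕ} (hn : 1 ≤ n) (ω : ℝ → ℝ) {M : ℝ} (hM : 0 ≤ M) : ∃ C : ℝ≥0,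
    ∀ (K : Rn n → Rn n → Rn n → ℝ) (T : (Rn n → ℝ) → (Rn n → ℝ) → Rn n → ℝ), NormCZ ω K T →
    ∀ b : Rn n → ℝ, LocallyIntegrable b volume → OscBound b M →
    ∀ f g : Rn n → ℝ, Integrable f → Integrable g → HasCompactSupport g →
    ∀ A α : ℝ, 0 < A → 0 < α → (∀ᵐ y, |f y| ≤ A) → (∀ᵐ y, |g y| ≤ α) →
    ∀ (c : Rn n) (R : ℝ), 0 < R → (∀ y, y ∉ closedBall c (R / 2) → f y = 0) →
      ∫⁻ x in closedBall c R, ENNReal.ofReal |b x - ballMean b c R| * ENNReal.ofReal |T f g x| ≤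
        C * ENNReal.ofReal (A * α * R ^ n) := by
  obtain ⟨J, hJ⟩ := johnStromberg_sq hn
  obtain ⟨C, hC⟩ := exists_bmo_const hn hM
  have hε := jsEps_pos n
  set V := (unitVol n).toReal with hV
  have hVe : unitVol n = ENNReal.ofReal V := (ENNReal.ofReal_toReal (unitVol_ne_top n)).symm
  set D := (ENNReal.ofReal (4 ^ n) * unitVol n ^ 2 * diniSum ω).toReal
  set B : ℝ := (4 ^ n / jsEps n) ^ 2 + 4 ^ n * 2 ^ (n + 1) * V ^ 2 + 2 * D with hB
  have hB0 : 0 < B := by positivity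
  refine ⟨C + J * (B ^ 2).toNNReal * V.toNNReal, ?_⟩
  intro K T h b hb hosc f g hf hg hgc A α hA hα hfA hgα c R hR hfs
  set f' : Rn n → ℝ := fun y => A⁻¹ * f y with hf'
  set g' : Rn n → ℝ := fun y => α⁻¹ * g y with hg'
  have if' : Integrable f' := hf.const_mul _
  have ig' : Integrable g' := hg.const_mul _
  have hf's : ∀ y, y ∉ closedBall c (R / 2) → f' y = 0 := fun y hy => by simp [hf', hfs y hy]
  have hg'c : HasCompactSupport g' := hgc.mul_left
  have hf'1 : ∀ᵐ y, |f' y| ≤ 1 := by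
    filter_upwards [hfA] with y hy
    rw [hf', abs_mul, abs_inv, abs_of_pos hA, inv_mul_le_iff₀ hA, mul_one]
    exact hy
  have hg'1 : ∀ᵐ y, |g' y| ≤ 1 := by
    filter_upwards [hgα] with y hy
    rw [hg', abs_mul, abs_inv, abs_of_pos hα, inv_mul_le_iff₀ hα, mul_one]
    exact hy
  have hT : ∀ x, T f g x = A * α * T f' g' x := by
    intro x
    rw [hf', hg', h.bilin.2.1 _ _ _ hf ig', h.bilin.2.2.2 _ _ _ hf hg]
    field_simp
  have hosc' : ∀ (x : Rn n) (r : ℝ), 0 < r → ∃ c, SmallOsc (T f' g') B x r c := fun x r hr => by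
    obtain ⟨c', hc'⟩ := h.smallOsc_bounded if' ig'
      (HasCompactSupport.intro (isCompact_closedBall _ _) hf's) hg'c hf'1 hg'1 x hr
    exact ⟨c', hc'.mono (by rw [hB]; linarith [show 0 ≤ 4 ^ n * 2 ^ (n + 1) * V ^ 2 by positivity])⟩
  have hsize : SmallOsc (T f' g') B c R 0 :=
    (h.smallOsc_size hn if' ig' hg'c hf'1 hg'1 hR hf's).mono (by
      rw [hB]; linarith [show 0 ≤ D from ENNReal.toReal_nonneg])
  have hTm := (h.meas f' g' if' ig').aemeasurable (μ := volume)
  have hbm := aemeasurable_of_locallyIntegrable hb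
  have hsq := hJ hTm hB0 hosc' c R 0 hR hsize
  simp only [sub_zero] at hsq
  set β := ballMean b c R
  calc ∫⁻ x in closedBall c R, ENNReal.ofReal |b x - β| * ENNReal.ofReal |T f g x|
      ≤ ∫⁻ x in closedBall c R, ENNReal.ofReal (A * α) *
          (ENNReal.ofReal ((b x - β) ^ 2) + ENNReal.ofReal (T f' g' x ^ 2)) := by
        refine lintegral_mono fun x => ?_
        rw [← ENNReal.ofReal_add (sq_nonneg _) (sq_nonneg _), ← ENNReal.ofReal_mul (abs_nonneg _),
          ← ENNReal.ofReal_mul (by positivity), hT, abs_mul, abs_of_pos (by positivity : 0 < A * α)]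
        refine ENNReal.ofReal_le_ofReal ?_
        rw [mul_left_comm]
        refine mul_le_mul_of_nonneg_left ?_ (by positivity)
        rw [← sq_abs (b x - β), ← sq_abs (T f' g' x)]
        nlinarith [sq_nonneg (|b x - β| - |T f' g' x|), sq_nonneg (|b x - β| + |T f' g' x|)]
    _ = ENNReal.ofReal (A * α) * ((∫⁻ x in closedBall c R, ENNReal.ofReal ((b x - β) ^ 2)) +
          ∫⁻ x in closedBall c R, ENNReal.ofReal (T f' g' x ^ 2)) := by
        rw [lintegral_const_mul' _ _ ENNReal.ofReal_ne_top,
          lintegral_add_left' ((hbm.sub_const _).pow_const 2).ennreal_ofReal.restrict]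
    _ ≤ ENNReal.ofReal (A * α) * (C * ENNReal.ofReal (R ^ n) +
          J * ENNReal.ofReal (B ^ 2) * volume (closedBall c R)) := by
        gcongr
        exact (hC b hb hosc c R hR).2.2
    _ = _ := by
        rw [volume_closedBall_Rn _ hR.le, hVe, ENNReal.ofReal_mul (by positivity : 0 ≤ A * α)]
        push_cast
        simp only [ENNReal.ofReal]
        ring

lemma IsDyadicCube.eq_preimage {n : ℕ} (k : ℤ) (m : Fin n → ℤ) :
    {x : Rn n | ∀ i, (2:ℝ) ^ k * (m i : ℝ) ≤ x i ∧ x i < (2:ℝ) ^ k * ((m i : ℝ) + 1)} =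
      WithLp.ofLp ⁻¹' (Set.pi univ fun i => Ico ((2:ℝ) ^ k * (m i : ℝ))
        ((2:ℝ) ^ k * ((m i : ℝ) + 1))) := by
  ext x
  simp [Set.mem_pi]

lemma IsDyadicCube.measurableSet {n : ℕ} {Q : Set (Rn n)} (hQ : IsDyadicCube Q) :
    MeasurableSet Q := by
  obtain ⟨k, m, rfl⟩ := hQ
  rw [IsDyadicCube.eq_preimage]
  exact (PiLp.volume_preserving_ofLp (Fin n)).measurable
    (MeasurableSet.univ_pi fun i => measurableSet_Ico)

lemma IsDyadicCube.volume_eq {n : ℕ} (k : ℤ) (m : Fin n → ℤ) :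
    volume {x : Rn n | ∀ i, (2:ℝ) ^ k * (m i : ℝ) ≤ x i ∧ x i < (2:ℝ) ^ k * ((m i : ℝ) + 1)} =
      ENNReal.ofReal (((2:ℝ) ^ k) ^ n) := by
  rw [IsDyadicCube.eq_preimage, (PiLp.volume_preserving_ofLp (Fin n)).measure_preimage
    (MeasurableSet.univ_pi fun i => measurableSet_Ico).nullMeasurableSet, Real.volume_pi_Ico]
  have : ∀ i, (2:ℝ) ^ k * ((m i : ℝ) + 1) - 2 ^ k * (m i : ℝ) = 2 ^ k := fun i => by ring
  simp only [this]
  rw [Finset.prod_const, Finset.card_univ, Fintype.card_fin, ENNReal.ofReal_pow (by positivity)]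

lemma IsDyadicCube.exists_ball {n : ℕ} (hn : 1 ≤ n) {Q : Set (Rn n)} (hQ : IsDyadicCube Q) :
    ∃ (c : Rn n) (R : ℝ), 0 < R ∧ Q ⊆ closedBall c (R / 2) ∧
      volume Q = ENNReal.ofReal ((R / n) ^ n) := by
  obtain ⟨k, m, rfl⟩ := hQ
  have hk : (0:ℝ) < 2 ^ k := by positivity
  have hn0 : (0:ℝ) < n := by exact_mod_cast hn
  refine ⟨WithLp.toLp 2 fun i => (2:ℝ) ^ k * ((m i : ℝ) + 1 / 2), n * 2 ^ k, by positivity,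
    fun x hx => ?_, ?_⟩
  · rw [mem_closedBall, dist_eq_norm]
    refine (norm_le_sum_abs _).trans ?_
    calc _ ≤ ∑ _i : Fin n, (2:ℝ) ^ k / 2 := by
          refine Finset.sum_le_sum fun i _ => ?_
          have h1 := (hx i).1
          have h2 := (hx i).2
          rw [PiLp.sub_apply]
          simp only [abs_le]
          constructor <;> nlinarith
      _ = _ := by simp; ring
  · rw [IsDyadicCube.volume_eq, mul_div_cancel_left₀ _ hn0.ne']

/-- Dyadic cubes are nested or disjoint. -/
lemma IsDyadicCube.subset_of_volume_le {n : ℕ} (hn : 1 ≤ n) {Q Q' : Set (Rn n)}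
    (hQ : IsDyadicCube Q) (hQ' : IsDyadicCube Q') (hv : volume Q ≤ volume Q') {x : Rn n}
    (hx : x ∈ Q) (hx' : x ∈ Q') : Q ⊆ Q' := by
  obtain ⟨k, m, rfl⟩ := hQ
  obtain ⟨k', m', rfl⟩ := hQ'
  rw [IsDyadicCube.volume_eq, IsDyadicCube.volume_eq, ENNReal.ofReal_le_ofReal_iff (by positivity),
    pow_le_pow_iff_left₀ (by positivity) (by positivity) (by omega),
    zpow_le_zpow_iff_right₀ (by norm_num)] at hv
  obtain ⟨j, rfl⟩ := Int.le.dest hv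
  have hk : (0:ℝ) < 2 ^ k := by positivity
  have hpow : (2:ℝ) ^ (k + (j : ℤ)) = 2 ^ k * ((2 ^ j : ℤ) : ℝ) := by
    rw [zpow_add₀ (by norm_num), zpow_natCast]; push_cast; rfl
  intro y hy i
  have h1 := hx i
  have h2 := hx' i
  have h3 := hy i
  rw [hpow, mul_assoc, mul_assoc] at h2 ⊢
  have e1 : (2 ^ j : ℤ) * m' i ≤ m i := by
    have : ((2 ^ j : ℤ) : ℝ) * (m' i : ℝ) < (m i : ℝ) + 1 :=
      lt_of_mul_lt_mul_left (h2.1.trans_lt h1.2) hk.le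
    exact Int.lt_add_one_iff.1 (by exact_mod_cast this)
  have e2 : m i + 1 ≤ (2 ^ j : ℤ) * (m' i + 1) := by
    have : (m i : ℝ) < ((2 ^ j : ℤ) : ℝ) * ((m' i : ℝ) + 1) :=
      lt_of_mul_lt_mul_left (h1.1.trans_lt h2.2) hk.le
    exact Int.add_one_le_iff.2 (by exact_mod_cast this)
  have e1' : ((2 ^ j : ℤ) : ℝ) * (m' i : ℝ) ≤ (m i : ℝ) := by exact_mod_cast e1
  have e2' : (m i : ℝ) + 1 ≤ ((2 ^ j : ℤ) : ℝ) * ((m' i : ℝ) + 1) := by exact_mod_cast e2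
  exact ⟨(mul_le_mul_of_nonneg_left e1' hk.le).trans h3.1,
    h3.2.trans_le (mul_le_mul_of_nonneg_left e2' hk.le)⟩

/-- An atom adapted to the ball of radius `R` around `c`. -/
structure IsBallAtom {n : ℕ} (a : Rn n → ℝ) (c : Rn n) (R : ℝ) : Prop where
  pos : 0 < R
  integrable : Integrable a
  eq_zero : ∀ y, y ∉ closedBall c (R / 2) → a y = 0
  bound : ∀ᵐ y, |a y| ≤ (n / R) ^ n
  integral : ∫ y, a y = 0
  l1norm_le : l1norm a ≤ 1

lemma IsH1Atom.isBallAtom {n : ℕ} (hn : 1 ≤ n) {Q : Set (Rn n)} {a : Rn n → ℝ}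
    (ha : IsH1Atom Q a) {c : Rn n} {R : ℝ} (hR : 0 < R)
    (hsub : Q ⊆ closedBall c (R / 2)) (hvol : volume Q = ENNReal.ofReal ((R / n) ^ n)) :
    IsBallAtom a c R := by
  obtain ⟨hm, hz, hbd, hint⟩ := ha
  have hn0 : (0:ℝ) < n := by exact_mod_cast hn
  have hvR : (volume Q).toReal = (R / n) ^ n := by
    rw [hvol, ENNReal.toReal_ofReal (by positivity)]
  have hvt : volume Q ≠ ⊤ := by rw [hvol]; exact ENNReal.ofReal_ne_top
  have hinv : ((volume Q).toReal)⁻¹ = (n / R) ^ n := by rw [hvR, ← inv_pow, inv_div]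
  have hQint : IntegrableOn a Q := by
    refine Measure.integrableOn_of_bounded hvt hm.aestronglyMeasurable
      (M := ((volume Q).toReal)⁻¹) (ae_restrict_of_ae hbd)
  have hint' : Integrable a :=
    (integrableOn_iff_integrable_of_support_subset fun y hy => by
      by_contra hcon
      exact hy (hz y hcon)).1 hQint
  refine ⟨hR, hint', fun y hy => hz y fun hyQ => hy (hsub hyQ), by rwa [hinv] at hbd, hint, ?_⟩
  have h1 : l1norm a = ∫ y in Q, |a y| :=
    (setIntegral_eq_integral_of_forall_compl_eq_zero fun y hy => by simp [hz y hy]).symm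
  rw [h1]
  calc ∫ y in Q, |a y| ≤ ∫ _ in Q, ((volume Q).toReal)⁻¹ :=
        integral_mono_ae hQint.abs (integrableOn_const hvt) (ae_restrict_of_ae hbd)
    _ = 1 := by
        rw [setIntegral_const, measureReal_def, smul_eq_mul, mul_inv_cancel₀]
        rw [hvR]; positivity

lemma IsBallAtom.hasCompactSupport {n : ℕ} {a : Rn n → ℝ} {c : Rn n} {R : ℝ}
    (ha : IsBallAtom a c R) : HasCompactSupport a :=
  HasCompactSupport.intro (isCompact_closedBall _ _) ha.eq_zero

lemma IsBallAtom.lintegral_le {n : ℕ} {a : Rn n → ℝ} {c : Rn n} {R : ℝ} (ha : IsBallAtom a c R) :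
    ∫⁻ y, ENNReal.ofReal |a y| ≤ 1 := by
  rw [lintegral_abs_eq_l1norm ha.integrable]
  exact ENNReal.ofReal_le_one.2 ha.l1norm_le

/-- Multiplying an atom by `b - b_B`, with `b` in BMO. -/
lemma IsBallAtom.bmo_mul {n : ℕ} (hn : 1 ≤ n) {a : Rn n → ℝ} {c : Rn n} {R : ℝ}
    (ha : IsBallAtom a c R) {b : Rn n → ℝ} (hb : LocallyIntegrable b volume) {C : ℝ≥0}
    (hC : ∫⁻ x in closedBall c R, ENNReal.ofReal |b x - ballMean b c R| ≤
      C * ENNReal.ofReal (R ^ n)) :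
    Integrable (fun y => (b y - ballMean b c R) * a y) ∧
      l1norm (fun y => (b y - ballMean b c R) * a y) ≤ C * (n:ℝ) ^ n := by
  have hR := ha.pos
  have hz : ∀ y, y ∉ closedBall c R → a y = 0 := fun y hy =>
    ha.eq_zero y fun hy' => hy (closedBall_subset_closedBall (by linarith) hy')
  set β := ballMean b c R
  have hbint : IntegrableOn (fun y => b y - β) (closedBall c R) :=
    (hb.integrableOn_isCompact (isCompact_closedBall _ _)).sub
      (integrableOn_const (volume_closedBall_ne_top _ _))
  have hint : Integrable (fun y => (b y - β) * a y) := by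
    refine (integrableOn_iff_integrable_of_support_subset fun y hy => ?_).1
      (Integrable.mul_bdd (c := (n / R) ^ n) hbint
        ha.integrable.aestronglyMeasurable.restrict (ae_restrict_of_ae ha.bound))
    by_contra hcon
    exact hy (by simp [hz y hcon])
  refine ⟨hint, ?_⟩
  rw [← ENNReal.ofReal_le_ofReal_iff (by positivity), ← lintegral_abs_eq_l1norm hint]
  calc ∫⁻ y, ENNReal.ofReal |(b y - β) * a y|
      ≤ ∫⁻ y, (closedBall c R).indicator
          (fun y => ENNReal.ofReal ((n / R) ^ n) * ENNReal.ofReal |b y - β|) y := by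
        refine lintegral_mono_ae ?_
        filter_upwards [ha.bound] with y hy
        by_cases hyb : y ∈ closedBall c R
        · rw [indicator_of_mem hyb, ← ENNReal.ofReal_mul (by positivity), abs_mul, mul_comm]
          gcongr
        · simp [hz y hyb]
    _ = ENNReal.ofReal ((n / R) ^ n) * ∫⁻ y in closedBall c R, ENNReal.ofReal |b y - β| := by
        rw [lintegral_indicator measurableSet_closedBall,
          lintegral_const_mul' _ _ ENNReal.ofReal_ne_top]
    _ ≤ ENNReal.ofReal ((n / R) ^ n) * (C * ENNReal.ofReal (R ^ n)) := by gcongr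
    _ = _ := by
        rw [← ENNReal.ofReal_coe_nnreal, ← ENNReal.ofReal_mul (by positivity),
          ← ENNReal.ofReal_mul (by positivity)]
        congr 1
        rw [div_pow]
        field_simp

/-- The constant in the measure bound of `exists_split`. -/
def splitConst (n : ℕ) : ℝ≥0∞ := ENNReal.ofReal (5 ^ n) * (ENNReal.ofReal (2 * (2 * n) ^ n) * unitVol n)

lemma splitConst_ne_top (n : ℕ) : splitConst n ≠ ⊤ :=
  ENNReal.mul_ne_top ENNReal.ofReal_ne_top
    (ENNReal.mul_ne_top ENNReal.ofReal_ne_top (unitVol_ne_top n))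

/-- A Calderón–Zygmund splitting of a finite atomic sum: outside the set `E` one is far from every
bad cube, and the good part is bounded by `α`. -/
theorem exists_split {n : ℕ} (hn : 1 ≤ n) {ι : Type*} [Fintype ι] [DecidableEq ι]
    {Q : ι → Set (Rn n)} {a : ι → Rn n → ℝ} {μ : ι → ℝ} (hQ : ∀ k, IsDyadicCube (Q k))
    (ha : ∀ k, IsH1Atom (Q k) (a k)) (hμ : ∑ k, |μ k| ≤ 1) {c : ι → Rn n} {R : ι → ℝ}
    (hR : ∀ k, 0 < R k) (hsub : ∀ k, Q k ⊆ closedBall (c k) (R k / 2))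
    (hvol : ∀ k, volume (Q k) = ENNReal.ofReal ((R k / n) ^ n)) {α : ℝ} (hα : 0 < α) :
    ∃ (B : Finset ι) (E : Set (Rn n)), volume E ≤ splitConst n / ENNReal.ofReal α ∧
      (∀ k ∈ B, ∀ x, x ∉ E → R k ≤ ‖x - c k‖) ∧
      ∀ᵐ x, |∑ k ∈ Bᶜ, μ k * a k x| ≤ α := by
  classical
  have hn0 : (0:ℝ) < n := by exact_mod_cast hn
  have hv0 : ∀ k, volume (Q k) ≠ 0 := fun k => by
    rw [hvol, ne_eq, ENNReal.ofReal_eq_zero, not_le]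
    have := hR k
    positivity
  have hvt : ∀ k, volume (Q k) ≠ ⊤ := fun k => by rw [hvol]; exact ENNReal.ofReal_ne_top
  have hα0 : ENNReal.ofReal α ≠ 0 := by simpa using hα
  set Φ : Rn n → ℝ≥0∞ := fun x =>
    ∑ k, (Q k).indicator (fun _ => ENNReal.ofReal |μ k| * (volume (Q k))⁻¹) x with hΦ
  have hΦm : Measurable Φ := Finset.measurable_sum _ fun k _ =>
    measurable_const.indicator (hQ k).measurableSet
  have hΦint : ∫⁻ x, Φ x ≤ 1 := by
    rw [hΦ, lintegral_finsetSum _ fun k _ => measurable_const.indicator (hQ k).measurableSet]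
    calc _ = ∑ k, ENNReal.ofReal |μ k| := Finset.sum_congr rfl fun k _ => by
            rw [lintegral_indicator_const (hQ k).measurableSet, mul_assoc,
              ENNReal.inv_mul_cancel (hv0 k) (hvt k), mul_one]
      _ = ENNReal.ofReal (∑ k, |μ k|) := (ENNReal.ofReal_sum_of_nonneg fun _ _ => abs_nonneg _).symm
      _ ≤ 1 := ENNReal.ofReal_le_one.2 hμ
  set Ω : Set (Rn n) := {x | ENNReal.ofReal α < Φ x} with hΩ
  have hΩm : MeasurableSet Ω := measurableSet_lt measurable_const hΦm
  have hΩle : Ω ⊆ {x | ENNReal.ofReal α ≤ Φ x} := by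
    intro x hx
    rw [hΩ, mem_ofPred_eq] at hx
    exact hx.le
  have hΩv : volume Ω ≤ 1 / ENNReal.ofReal α :=
    le_trans (measure_mono (t := {x | ENNReal.ofReal α ≤ Φ x}) hΩle)
      ((meas_ge_le_lintegral_div hΦm.aemeasurable hα0 ENNReal.ofReal_ne_top).trans
        (ENNReal.div_le_div_right hΦint _))
  set q : ℝ≥0∞ := ENNReal.ofReal (2 * (2 * n) ^ n) * unitVol n with hq
  have hq0 : q ≠ 0 := mul_ne_zero (by simp) (unitVol_ne_zero n)
  have hqt : q ≠ ⊤ := ENNReal.mul_ne_top ENNReal.ofReal_ne_top (unitVol_ne_top n)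
  set E : Set (Rn n) := {x | ∃ r : ℝ, 0 < r ∧
    q⁻¹ * volume (closedBall x r) < ∫⁻ y in closedBall x r, Ω.indicator 1 y} with hE
  have hΩi : ∫⁻ y, Ω.indicator (1 : Rn n → ℝ≥0∞) y = volume Ω := lintegral_indicator_one hΩm
  have hEv : volume E ≤ splitConst n / ENNReal.ofReal α := by
    refine (hardyLittlewood_weak hn (Ω.indicator 1) ?_ (ENNReal.inv_ne_zero.2 hqt)
      (ENNReal.inv_ne_top.2 hq0)).trans ?_
    · rw [hΩi]
      exact ne_top_of_le_ne_top (ENNReal.div_ne_top ENNReal.one_ne_top hα0) hΩv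
    · rw [hΩi, div_eq_mul_inv, inv_inv, splitConst, mul_div_assoc, ← hq]
      refine mul_le_mul_right ?_ _
      rw [mul_comm, div_eq_mul_inv, ← one_div]
      exact mul_le_mul_right hΩv _
  refine ⟨Finset.univ.filter fun k => Q k ⊆ Ω, E, hEv, ?_, ?_⟩
  · intro k hk x hx
    have hkΩ : Q k ⊆ Ω := (Finset.mem_filter.1 hk).2
    by_contra! hcon
    refine hx ⟨2 * R k, by linarith [hR k], ?_⟩
    have hRk := hR k
    have hQsub : Q k ⊆ closedBall x (2 * R k) ∩ Ω := by
      refine subset_inter (fun y hy => ?_) hkΩ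
      have h1 : dist y (c k) ≤ R k / 2 := hsub k hy
      have h2 : dist (c k) x < R k := by rwa [dist_comm, dist_eq_norm]
      rw [mem_closedBall]
      linarith [dist_triangle y (c k) x]
    have h3 : volume (Q k) ≤ ∫⁻ y in closedBall x (2 * R k), Ω.indicator 1 y := by
      rw [lintegral_indicator_one hΩm, Measure.restrict_apply hΩm, inter_comm]
      exact measure_mono hQsub
    refine lt_of_lt_of_le ?_ h3
    rw [mul_comm, ← div_eq_mul_inv, ENNReal.div_lt_iff (Or.inl hq0) (Or.inl hqt), hvol, hq,
      volume_closedBall_Rn _ (by positivity), ← mul_assoc, ← ENNReal.ofReal_mul (by positivity)]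
    refine (ENNReal.mul_lt_mul_iff_left (unitVol_ne_zero n) (unitVol_ne_top n)).2 ?_
    refine (ENNReal.ofReal_lt_ofReal_iff (by positivity)).2 ?_
    rw [mul_left_comm, ← mul_pow, show R k / n * (2 * n) = 2 * R k by field_simp]
    have : 0 < (2 * R k) ^ n := by positivity
    linarith
  · have hbd : ∀ᵐ x, ∀ k, |a k x| ≤ ((volume (Q k)).toReal)⁻¹ := ae_all_iff.2 fun k => (ha k).2.2.1
    filter_upwards [hbd] with x hx
    set G := ((Finset.univ.filter fun k => Q k ⊆ Ω)ᶜ).filter fun k => x ∈ Q k with hG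
    have hsum : ∑ k ∈ (Finset.univ.filter fun k => Q k ⊆ Ω)ᶜ, μ k * a k x =
        ∑ k ∈ G, μ k * a k x := by
      rw [hG, Finset.sum_filter]
      refine Finset.sum_congr rfl fun k _ => ?_
      split_ifs with hk
      · rfl
      · rw [(ha k).2.1 x hk, mul_zero]
    rw [hsum]
    rcases G.eq_empty_or_nonempty with hemp | hne
    · rw [hemp]; simpa using hα.le
    · obtain ⟨k₀, hk₀, hmin⟩ := G.exists_min_image (fun k => volume (Q k)) hne
      have hk₀' : ¬ Q k₀ ⊆ Ω ∧ x ∈ Q k₀ := by simpa [hG] using hk₀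
      obtain ⟨z, hz, hzΩ⟩ := not_subset.1 hk₀'.1
      rw [← ENNReal.ofReal_le_ofReal_iff hα.le]
      calc ENNReal.ofReal |∑ k ∈ G, μ k * a k x|
          ≤ ENNReal.ofReal (∑ k ∈ G, |μ k * a k x|) :=
            ENNReal.ofReal_le_ofReal (Finset.abs_sum_le_sum_abs _ _)
        _ = ∑ k ∈ G, ENNReal.ofReal |μ k * a k x| :=
            ENNReal.ofReal_sum_of_nonneg fun _ _ => abs_nonneg _
        _ ≤ ∑ k ∈ G, (Q k).indicator (fun _ => ENNReal.ofReal |μ k| * (volume (Q k))⁻¹) z := by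
            refine Finset.sum_le_sum fun k hk => ?_
            have hxk : x ∈ Q k := (Finset.mem_filter.1 hk).2
            have hzk : z ∈ Q k :=
              (hQ k₀).subset_of_volume_le hn (hQ k) (hmin k hk) hk₀'.2 hxk hz
            rw [indicator_of_mem hzk, abs_mul, ENNReal.ofReal_mul (abs_nonneg _)]
            refine mul_le_mul_right ?_ _
            calc ENNReal.ofReal |a k x| ≤ ENNReal.ofReal ((volume (Q k)).toReal)⁻¹ :=
                  ENNReal.ofReal_le_ofReal (hx k)
              _ = (volume (Q k))⁻¹ := by
                  rw [← ENNReal.toReal_inv, ENNReal.ofReal_toReal (ENNReal.inv_ne_top.2 (hv0 k))]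
        _ ≤ Φ z := Finset.sum_le_univ_sum_of_nonneg fun _ => zero_le
        _ ≤ ENNReal.ofReal α := not_lt.1 hzΩ

/-- The decay profile `ω(R/|x-c|) |x-c|⁻ⁿ` outside the ball of radius `R` around `c`. -/
def farWeight {n : ℕ} (ω : ℝ → ℝ) (c : Rn n) (R : ℝ) : Rn n → ℝ≥0∞ :=
  {x | R ≤ ‖x - c‖}.indicator fun x => ENNReal.ofReal (ω (R / ‖x - c‖) / ‖x - c‖ ^ n)

/-- The constant in the Poisson-type bound for `T`. -/
def poissonConst (n : ℕ) : ℝ≥0∞ := ENNReal.ofReal (2 ^ (n + 1)) * unitVol n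

lemma poissonConst_ne_top (n : ℕ) : poissonConst n ≠ ⊤ :=
  ENNReal.mul_ne_top ENNReal.ofReal_ne_top (unitVol_ne_top n)

lemma measurableSet_le_norm_sub {n : ℕ} (c : Rn n) (R : ℝ) :
    MeasurableSet {x : Rn n | R ≤ ‖x - c‖} :=
  measurableSet_le measurable_const (by fun_prop)

lemma measurable_farWeight {n : ℕ} {ω : ℝ → ℝ} (hω : Monotone ω) (c : Rn n) (R : ℝ) :
    Measurable (farWeight ω c R) := by
  have hm := hω.measurable
  refine Measurable.indicator ?_ (measurableSet_le_norm_sub c R)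
  exact ((hm.comp (by fun_prop)).div (by fun_prop)).ennreal_ofReal

lemma lintegral_abs_closedBall_le {n : ℕ} {f : Rn n → ℝ} {A : ℝ} (hf : ∀ᵐ y, |f y| ≤ A)
    (x : Rn n) (s : ℝ) :
    ∫⁻ y in closedBall x s, ENNReal.ofReal |f y| ≤
      ENNReal.ofReal A * volume (closedBall x s) := by
  rw [← setLIntegral_const]
  refine lintegral_mono_ae (ae_restrict_of_ae ?_)
  filter_upwards [hf] with y hy using ENNReal.ofReal_le_ofReal hy

namespace NormCZ

variable {n : ℕ} {ω : ℝ → ℝ} {K : Rn n → Rn n → Rn n → ℝ}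
  {T : (Rn n → ℝ) → (Rn n → ℝ) → Rn n → ℝ}

lemma map_sum_left (h : NormCZ ω K T) {ι : Type*} (s : Finset ι) (μ : ι → ℝ) {f : ι → Rn n → ℝ}
    {g : Rn n → ℝ} (hf : ∀ i, Integrable (f i)) (hg : Integrable g) (x : Rn n) :
    T (fun y => ∑ i ∈ s, μ i * f i y) g x = ∑ i ∈ s, μ i * T (f i) g x := by
  classical
  induction s using Finset.induction_on with
  | empty => simpa using h.bilin.2.1 0 g g hg hg x
  | insert i s hi ih =>
    simp only [Finset.sum_insert hi]
    rw [h.bilin.1 _ _ _ ((hf i).const_mul _)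
      (integrable_finsetSum _ fun j _ => (hf j).const_mul _) hg, h.bilin.2.1 _ _ _ (hf i) hg, ih]

lemma map_sum_right (h : NormCZ ω K T) {ι : Type*} (s : Finset ι) (μ : ι → ℝ) {f : ι → Rn n → ℝ}
    {g : Rn n → ℝ} (hf : ∀ i, Integrable (f i)) (hg : Integrable g) (x : Rn n) :
    T g (fun y => ∑ i ∈ s, μ i * f i y) x = ∑ i ∈ s, μ i * T g (f i) x :=
  h.swap.map_sum_left s μ hf hg x

/-- Decay of `T(a,g)` away from the ball of an atom `a`, where `g` has bounded averages. -/
lemma atom_far (hn : 1 ≤ n) (h : NormCZ ω K T) {a : Rn n → ℝ} {c : Rn n} {R : ℝ}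
    (ha : IsBallAtom a c R) {g : Rn n → ℝ} (hg : Integrable g) (hgs : HasCompactSupport g)
    (A : ℝ≥0∞) : ∀ᵐ x, R ≤ ‖x - c‖ →
      (∀ s, 0 < s → ∫⁻ y in closedBall x s, ENNReal.ofReal |g y| ≤ A * volume (closedBall x s)) →
      ENNReal.ofReal |T a g x| ≤ poissonConst n * A * farWeight ω c R x := by
  filter_upwards [h.cancel ha.integrable hg hgs ha.pos ha.eq_zero ha.integral] with x hx hxR hA
  have hr : 0 < ‖x - c‖ := ha.pos.trans_le hxR
  rw [farWeight, indicator_of_mem (by exact hxR)]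
  calc ENNReal.ofReal |T a g x|
      ≤ ENNReal.ofReal (ω (R / ‖x - c‖)) * 1 *
          (A * unitVol n * ENNReal.ofReal (2 ^ (n + 1) / ‖x - c‖ ^ n)) := by
        refine (hx hxR).trans ?_
        gcongr
        · exact ha.lintegral_le
        · exact lintegral_poisson hn hr fun s hs => hA s (hr.trans_le hs)
    _ = _ := by
        rw [poissonConst, div_eq_mul_inv ((2:ℝ) ^ (n + 1)), div_eq_mul_inv (ω _), ENNReal.ofReal_mul (by positivity),
          ENNReal.ofReal_mul (h.nonneg _)]
        ring

/-- Pointwise bound for `T(a, G + ∑ μₖ a'ₖ)`, for atoms `a` and `a'ₖ`. -/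
lemma atom_pointwise (hn : 1 ≤ n) (h : NormCZ ω K T) {a : Rn n → ℝ} {c : Rn n} {R : ℝ}
    (ha : IsBallAtom a c R) {κ : Type*} [Fintype κ] {a' : κ → Rn n → ℝ} {c' : κ → Rn n}
    {R' : κ → ℝ} (ha' : ∀ k, IsBallAtom (a' k) (c' k) (R' k)) (B : Finset κ) (μ : κ → ℝ)
    {f G : Rn n → ℝ} (hf : Integrable f) (hfs : HasCompactSupport f) (hG : Integrable G)
    (hfG : f = fun y => G y + ∑ k ∈ B, μ k * a' k y) (α : ℝ) : ∀ᵐ x,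
      (∀ s, 0 < s → ∫⁻ y in closedBall x s, ENNReal.ofReal |f y| ≤
        ENNReal.ofReal α * volume (closedBall x s)) →
      (∀ k ∈ B, R' k ≤ ‖x - c' k‖) →
      ENNReal.ofReal |T a f x| ≤ poissonConst n * ENNReal.ofReal α * farWeight ω c R x +
        (closedBall c R).indicator 1 x * ENNReal.ofReal |T a G x| +
        poissonConst n * (((closedBall c R).indicator 1 x * ENNReal.ofReal ((n / R) ^ n)) *
          ∑ k, ENNReal.ofReal |μ k| * farWeight ω (c' k) (R' k) x) := by
  have hbad : ∀ᵐ x, ∀ k, R' k ≤ ‖x - c' k‖ → ENNReal.ofReal |T a (a' k) x| ≤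
      poissonConst n * ENNReal.ofReal ((n / R) ^ n) * farWeight ω (c' k) (R' k) x := by
    refine ae_all_iff.2 fun k => ?_
    filter_upwards [h.swap.atom_far hn (ha' k) ha.integrable ha.hasCompactSupport
      (ENNReal.ofReal ((n / R) ^ n))] with x hx hk
    exact hx hk fun s _ => lintegral_abs_closedBall_le ha.bound x s
  filter_upwards [hbad, h.atom_far hn ha hf hfs (ENNReal.ofReal α)] with x hb hfar hA hB
  rcases le_or_gt R ‖x - c‖ with hxR | hxR
  · rw [add_assoc]
    exact (hfar hxR hA).trans le_self_add
  · have hxc : x ∈ closedBall c R := by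
      rw [mem_closedBall, dist_eq_norm]; exact hxR.le
    rw [indicator_of_mem hxc, add_assoc]
    refine le_trans ?_ le_add_self
    rw [Pi.one_apply, one_mul, one_mul, hfG, h.bilin.2.2.1 _ _ _ ha.integrable hG
      (integrable_finsetSum _ fun k _ => (ha' k).integrable.const_mul _),
      h.map_sum_right B μ (fun k => (ha' k).integrable) ha.integrable]
    calc _ ≤ ENNReal.ofReal (|T a G x| + ∑ k ∈ B, |μ k| * |T a (a' k) x|) := by
          refine ENNReal.ofReal_le_ofReal ((abs_add_le _ _).trans (add_le_add le_rfl ?_))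
          refine (Finset.abs_sum_le_sum_abs _ _).trans_eq ?_
          simp only [abs_mul]
      _ = ENNReal.ofReal |T a G x| +
          ∑ k ∈ B, ENNReal.ofReal |μ k| * ENNReal.ofReal |T a (a' k) x| := by
          rw [ENNReal.ofReal_add (abs_nonneg _) (by positivity),
            ENNReal.ofReal_sum_of_nonneg fun k _ => by positivity]
          simp only [ENNReal.ofReal_mul (abs_nonneg _)]
      _ ≤ ENNReal.ofReal |T a G x| + ∑ k ∈ B, ENNReal.ofReal |μ k| *
          (poissonConst n * ENNReal.ofReal ((n / R) ^ n) * farWeight ω (c' k) (R' k) x) := by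
          gcongr with k hk
          exact hb k (hB k hk)
      _ ≤ ENNReal.ofReal |T a G x| + ∑ k, ENNReal.ofReal |μ k| *
          (poissonConst n * ENNReal.ofReal ((n / R) ^ n) * farWeight ω (c' k) (R' k) x) := by
          gcongr
          exact Finset.subset_univ _
      _ = _ := by
          rw [Finset.mul_sum, Finset.mul_sum]
          congr 1
          exact Finset.sum_congr rfl fun k _ => by ring

end NormCZ

/-- A Chebyshev estimate for a quadratic expression. -/
lemma volume_quadratic_le {n : ℕ} {F₁ F₂ F₃ F₄ : Rn n → ℝ≥0∞} (h₁ : AEMeasurable F₁)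
    (h₂ : AEMeasurable F₂) (h₃ : AEMeasurable F₃) (h₄ : AEMeasurable F₄) {C : ℝ≥0∞} {α : ℝ}
    (hα : 0 < α) (i₁ : ∫⁻ x, F₁ x ≤ C) (i₂ : ∫⁻ x, F₂ x ≤ C * ENNReal.ofReal α)
    (i₃ : ∫⁻ x, F₃ x ≤ C) (i₄ : ∫⁻ x, F₄ x ≤ C) (p : ℝ≥0) :
    volume {x | ENNReal.ofReal (α ^ 2 / 2) <
      p * ENNReal.ofReal α * F₁ x + F₂ x + p * (F₃ x * F₄ x)} ≤
      ENNReal.ofReal (16 * (p + 1)) * C / ENNReal.ofReal α := by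
  set κ : ℝ := 1 / (4 * (p + 1)) with hκ
  have hp : (0:ℝ) ≤ p := p.2
  have hκ0 : 0 < κ := by positivity
  have markov : ∀ {F : Rn n → ℝ≥0∞}, AEMeasurable F → ∀ {u : ℝ}, 0 < u →
      volume {x | ENNReal.ofReal u ≤ F x} ≤ (∫⁻ x, F x) / ENNReal.ofReal u := fun hF u hu =>
    meas_ge_le_lintegral_div hF (by simpa using hu) ENNReal.ofReal_ne_top
  have hdiv : ∀ {I : ℝ≥0∞}, I ≤ C → I / ENNReal.ofReal (κ * α) ≤
      ENNReal.ofReal (4 * (p + 1)) * C / ENNReal.ofReal α := by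
    intro I hI
    rw [ENNReal.ofReal_mul hκ0.le, hκ, one_div, ENNReal.ofReal_inv_of_pos (by positivity),
      mul_comm (ENNReal.ofReal _) C, div_eq_mul_inv, div_eq_mul_inv,
      ENNReal.mul_inv (Or.inr ENNReal.ofReal_ne_top) (Or.inr (by simpa using hα)), inv_inv,
      mul_assoc C]
    gcongr
  have m₁ := (markov h₁ (mul_pos hκ0 hα)).trans (hdiv i₁)
  have m₃ := (markov h₃ (mul_pos hκ0 hα)).trans (hdiv i₃)
  have m₄ := (markov h₄ (mul_pos hκ0 hα)).trans (hdiv i₄)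
  have m₂ : volume {x | ENNReal.ofReal (κ * α * α) ≤ F₂ x} ≤
      ENNReal.ofReal (4 * (p + 1)) * C / ENNReal.ofReal α := by
    refine (markov h₂ (by positivity)).trans (le_trans ?_ (hdiv le_rfl))
    rw [ENNReal.ofReal_mul (p := κ * α) (by positivity)]
    refine (ENNReal.div_le_div_right i₂ _).trans_eq ?_
    exact ENNReal.mul_div_mul_right _ _ (by simpa using hα) ENNReal.ofReal_ne_top
  have hsub : {x | ENNReal.ofReal (α ^ 2 / 2) <
      p * ENNReal.ofReal α * F₁ x + F₂ x + p * (F₃ x * F₄ x)} ⊆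
      (({x | ENNReal.ofReal (κ * α) ≤ F₁ x} ∪ {x | ENNReal.ofReal (κ * α * α) ≤ F₂ x}) ∪
        {x | ENNReal.ofReal (κ * α) ≤ F₃ x}) ∪ {x | ENNReal.ofReal (κ * α) ≤ F₄ x} := by
    intro x hx
    by_contra hcon
    simp only [mem_union, mem_ofPred_eq, not_or, not_le] at hcon hx
    obtain ⟨⟨⟨q₁, q₂⟩, q₃⟩, q₄⟩ := hcon
    refine absurd hx (not_lt.2 ?_)
    calc _ ≤ p * ENNReal.ofReal α * ENNReal.ofReal (κ * α) + ENNReal.ofReal (κ * α * α) +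
          p * (ENNReal.ofReal (κ * α) * ENNReal.ofReal (κ * α)) := by gcongr
      _ = ENNReal.ofReal (p * α * (κ * α) + κ * α * α + p * (κ * α * (κ * α))) := by
          rw [ENNReal.ofReal_add (by positivity) (by positivity),
            ENNReal.ofReal_add (by positivity) (by positivity),
            ENNReal.ofReal_mul (p := p * α) (by positivity), ENNReal.ofReal_mul (q := α) hp,
            ENNReal.ofReal_mul (q := κ * α * (κ * α)) hp, ENNReal.ofReal_coe_nnreal,
            ENNReal.ofReal_mul (p := κ * α) (q := κ * α) (by positivity)]
      _ ≤ _ := by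
          refine ENNReal.ofReal_le_ofReal ?_
          have e1 : κ * (p + 1) = 1 / 4 := by rw [hκ]; field_simp
          have e2 : κ ≤ 1 := by nlinarith [mul_nonneg hκ0.le hp]
          have e3 : p * κ ^ 2 ≤ p * κ := by
            rw [pow_two]; nlinarith [mul_nonneg hκ0.le hp]
          have e4 : p * κ + κ + p * κ ^ 2 ≤ 1 / 2 := by nlinarith
          nlinarith [mul_le_mul_of_nonneg_right e4 (sq_nonneg α)]
  refine (measure_mono hsub).trans ?_
  calc _ ≤ ENNReal.ofReal (4 * (p + 1)) * C / ENNReal.ofReal α +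
        ENNReal.ofReal (4 * (p + 1)) * C / ENNReal.ofReal α +
        ENNReal.ofReal (4 * (p + 1)) * C / ENNReal.ofReal α +
        ENNReal.ofReal (4 * (p + 1)) * C / ENNReal.ofReal α := by
        refine (measure_union_le _ _).trans (add_le_add ?_ m₄)
        refine (measure_union_le _ _).trans (add_le_add ?_ m₃)
        exact (measure_union_le _ _).trans (add_le_add m₁ m₂)
    _ = _ := by
        rw [show (16 * ((p:ℝ) + 1)) = 4 * (4 * (p + 1)) by ring,
          ENNReal.ofReal_mul (p := (4:ℝ)) (q := 4 * (p + 1)) (by norm_num),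
          show ENNReal.ofReal 4 = 4 by simp, mul_assoc, mul_div_assoc 4]
        ring

lemma lintegral_weighted_sum_le {n : ℕ} {ι : Type*} [Fintype ι] {μ : ι → ℝ} (hμ : ∑ i, |μ i| ≤ 1)
    {F : ι → Rn n → ℝ≥0∞} (hF : ∀ i, AEMeasurable (F i)) {C : ℝ≥0∞} (hC : ∀ i, ∫⁻ x, F i x ≤ C) :
    ∫⁻ x, ∑ i, ENNReal.ofReal |μ i| * F i x ≤ C := by
  rw [lintegral_finsetSum' _ fun i _ => (hF i).const_mul _]
  calc _ = ∑ i, ENNReal.ofReal |μ i| * ∫⁻ x, F i x :=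
        Finset.sum_congr rfl fun i _ => lintegral_const_mul' _ _ ENNReal.ofReal_ne_top
    _ ≤ ∑ i, ENNReal.ofReal |μ i| * C := by gcongr with i; exact hC i
    _ = ENNReal.ofReal (∑ i, |μ i|) * C := by
        rw [ENNReal.ofReal_sum_of_nonneg fun _ _ => abs_nonneg _, Finset.sum_mul]
    _ ≤ 1 * C := by gcongr; exact ENNReal.ofReal_le_one.2 hμ
    _ = C := one_mul C

lemma l1norm_weighted_sum_le {n : ℕ} {ι : Type*} [Fintype ι] {μ : ι → ℝ} (hμ : ∑ i, |μ i| ≤ 1)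
    {f : ι → Rn n → ℝ} (hf : ∀ i, Integrable (f i)) {C : ℝ} (hC : ∀ i, l1norm (f i) ≤ C)
    (hC0 : 0 ≤ C) : l1norm (fun x => ∑ i, μ i * f i x) ≤ C := by
  have hint : Integrable fun x => ∑ i, μ i * f i x :=
    integrable_finsetSum _ fun i _ => (hf i).const_mul _
  rw [← ENNReal.ofReal_le_ofReal_iff hC0, ← lintegral_abs_eq_l1norm hint]
  refine le_trans (lintegral_mono fun x => ?_) (lintegral_weighted_sum_le hμ
    (F := fun i x => ENNReal.ofReal |f i x|)
    (fun i => (hf i).aestronglyMeasurable.aemeasurable.abs.ennreal_ofReal) fun i => ?_)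
  · calc ENNReal.ofReal |∑ i, μ i * f i x| ≤ ENNReal.ofReal (∑ i, |μ i| * |f i x|) := by
          refine ENNReal.ofReal_le_ofReal ((Finset.abs_sum_le_sum_abs _ _).trans_eq ?_)
          simp only [abs_mul]
      _ = _ := by
          rw [ENNReal.ofReal_sum_of_nonneg fun i _ => by positivity]
          simp only [ENNReal.ofReal_mul (abs_nonneg _)]
  · rw [lintegral_abs_eq_l1norm (hf i)]
    exact ENNReal.ofReal_le_ofReal (hC i)

lemma lintegral_mul_indicator {n : ℕ} {s : Set (Rn n)} (hs : MeasurableSet s)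
    (f g : Rn n → ℝ≥0∞) : ∫⁻ x, f x * s.indicator g x = ∫⁻ x in s, f x * g x := by
  rw [← lintegral_indicator hs]
  simp only [indicator_mul_right]

lemma lintegral_mul_indicator_one_mul {n : ℕ} {s : Set (Rn n)} (hs : MeasurableSet s)
    (f g : Rn n → ℝ≥0∞) :
    ∫⁻ x, f x * (s.indicator 1 x * g x) = ∫⁻ x in s, f x * g x := by
  rw [← lintegral_mul_indicator hs]
  refine lintegral_congr fun x => ?_
  by_cases hx : x ∈ s <;> simp [hx]

lemma lintegral_farWeight_le {n : ℕ} (c : Rn n) {R : ℝ} (hR : 0 < R) {ω : ℝ → ℝ}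
    (hω0 : ∀ t, 0 ≤ ω t) (hωm : Monotone ω) :
    ∫⁻ x, farWeight ω c R x ≤ ENNReal.ofReal (2 ^ n) * unitVol n * diniSum ω := by
  rw [farWeight, lintegral_indicator (measurableSet_le_norm_sub c R)]
  exact lintegral_far_one c hR hω0 hωm

lemma ofReal_abs_weighted_sum_le {ι : Type*} [Fintype ι] (μ u v : ι → ℝ) :
    ENNReal.ofReal |∑ i, μ i * (u i * v i)| ≤
      ∑ i, ENNReal.ofReal |μ i| * (ENNReal.ofReal |u i| * ENNReal.ofReal |v i|) := by
  simp only [← ENNReal.ofReal_mul (abs_nonneg _), ← abs_mul]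
  rw [← ENNReal.ofReal_sum_of_nonneg fun _ _ => abs_nonneg _]
  exact ENNReal.ofReal_le_ofReal (Finset.abs_sum_le_sum_abs _ _)

/-- The measure bound for the main part of the commutator. -/
theorem exists_main_const {n : ℕ} (hn : 1 ≤ n) (ω : ℝ → ℝ) {M : ℝ} (hM : 0 ≤ M)
    (hdini : diniSum ω ≠ ⊤) : ∃ C : ℝ≥0,
    ∀ (K : Rn n → Rn n → Rn n → ℝ) (T : (Rn n → ℝ) → (Rn n → ℝ) → Rn n → ℝ), NormCZ ω K T →
    ∀ b : Rn n → ℝ, LocallyIntegrable b volume → OscBound b M →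
    ∀ (ι κ : Type) [Fintype ι] [Fintype κ] [DecidableEq κ],
    ∀ (lam : ι → ℝ) (a : ι → Rn n → ℝ) (c : ι → Rn n) (R : ι → ℝ), ∑ j, |lam j| ≤ 1 →
      (∀ j, IsBallAtom (a j) (c j) (R j)) →
    ∀ (μ : κ → ℝ) (a' : κ → Rn n → ℝ) (c' : κ → Rn n) (R' : κ → ℝ), ∑ k, |μ k| ≤ 1 →
      (∀ k, IsBallAtom (a' k) (c' k) (R' k)) →
    ∀ (f : Rn n → ℝ), (f = fun y => ∑ k, μ k * a' k y) →
    ∀ (B : Finset κ) (E : Set (Rn n)) (α : ℝ), 0 < α →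
      (∀ k ∈ B, ∀ x, x ∉ E → R' k ≤ ‖x - c' k‖) →
      (∀ᵐ x, |∑ k ∈ Bᶜ, μ k * a' k x| ≤ α) →
      volume {x | α ^ 2 / 2 <
          |∑ j, lam j * ((b x - ballMean b (c j) (R j)) * T (a j) f x)|} ≤
        volume E + C / ENNReal.ofReal α := by
  obtain ⟨C₁, hC₁⟩ := exists_bmo_const hn hM
  obtain ⟨C₂, hC₂⟩ := exists_near_const hn ω hM
  set p : ℝ≥0 := (poissonConst n).toNNReal with hp
  have hpe : (p : ℝ≥0∞) = poissonConst n := ENNReal.coe_toNNReal (poissonConst_ne_top n)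
  set I : ℝ≥0∞ := C₁ * diniSum ω + C₂ * ENNReal.ofReal (n ^ n) + C₁ * ENNReal.ofReal (n ^ n) +
    ENNReal.ofReal (2 ^ n) * unitVol n * diniSum ω with hI
  have hIt : I ≠ ⊤ := by
    have := unitVol_ne_top n
    finiteness
  set CC : ℝ≥0∞ := ENNReal.ofReal (5 ^ n) + ENNReal.ofReal (16 * (p + 1)) * I with hCC
  have hCCt : CC ≠ ⊤ := by finiteness
  refine ⟨CC.toNNReal, ?_⟩
  rw [ENNReal.coe_toNNReal hCCt]
  intro K T h b hb hosc ι κ _ _ _ lam a c R hlam ha μ a' c' R' hμ ha' f hf B E α hα hB hG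
  have hn0 : (0:ℝ) < n := by exact_mod_cast hn
  set G : Rn n → ℝ := fun y => ∑ k ∈ Bᶜ, μ k * a' k y with hGdef
  have iG : Integrable G := integrable_finsetSum _ fun k _ => (ha' k).integrable.const_mul _
  have hfG : f = fun y => G y + ∑ k ∈ B, μ k * a' k y := by
    rw [hf]; funext y; exact (Finset.sum_compl_add_sum B _).symm
  have hcs : ∀ s : Finset κ, HasCompactSupport fun y => ∑ k ∈ s, μ k * a' k y := by
    intro s
    refine HasCompactSupport.intro (K := ⋃ k, closedBall (c' k) (R' k / 2))
      (isCompact_iUnion fun k => isCompact_closedBall _ _) fun y hy => ?_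
    refine Finset.sum_eq_zero fun k _ => ?_
    rw [(ha' k).eq_zero y fun hk => hy (mem_iUnion.2 ⟨k, hk⟩), mul_zero]
  have hGs : HasCompactSupport G := hcs _
  have hfs : HasCompactSupport f := by rw [hf]; exact hcs _
  have hfi : Integrable f := by
    rw [hf]; exact integrable_finsetSum _ fun k _ => (ha' k).integrable.const_mul _
  have hf1 : ∫⁻ y, ENNReal.ofReal |f y| ≤ 1 := by
    rw [lintegral_abs_eq_l1norm hfi, hf]
    exact ENNReal.ofReal_le_one.2 (l1norm_weighted_sum_le hμ (fun k => (ha' k).integrable)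
      (fun k => (ha' k).l1norm_le) zero_le_one)
  have hbm := aemeasurable_of_locallyIntegrable hb
  set P : ι → Rn n → ℝ≥0∞ := fun j x => ENNReal.ofReal |b x - ballMean b (c j) (R j)| with hP
  have hPm : ∀ j, AEMeasurable (P j) := fun j => (hbm.sub_const _).abs.ennreal_ofReal
  set D : ι → Set (Rn n) := fun j => closedBall (c j) (R j) with hD
  have hDm : ∀ j, MeasurableSet (D j) := fun j => measurableSet_closedBall
  have hDi : ∀ j, Measurable ((D j).indicator (1 : Rn n → ℝ≥0∞)) := fun j =>
    measurable_one.indicator (hDm j)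
  have hTm : ∀ j, Measurable fun x => ENNReal.ofReal |T (a j) G x| := fun j =>
    (h.meas _ _ (ha j).integrable iG).abs.ennreal_ofReal
  set F₁ : ι → Rn n → ℝ≥0∞ := fun j x => P j x * farWeight ω (c j) (R j) x with hF₁
  set F₂ : ι → Rn n → ℝ≥0∞ := fun j x =>
    P j x * ((D j).indicator 1 x * ENNReal.ofReal |T (a j) G x|) with hF₂
  set F₃ : ι → Rn n → ℝ≥0∞ := fun j x =>
    P j x * ((D j).indicator 1 x * ENNReal.ofReal ((n / R j) ^ n)) with hF₃
  have m₁ : ∀ j, AEMeasurable (F₁ j) := fun j =>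
    (hPm j).mul (measurable_farWeight h.mono _ _).aemeasurable
  have m₂ : ∀ j, AEMeasurable (F₂ j) := fun j => (hPm j).mul ((hDi j).mul (hTm j)).aemeasurable
  have m₃ : ∀ j, AEMeasurable (F₃ j) := fun j =>
    (hPm j).mul ((hDi j).mul measurable_const).aemeasurable
  have m₄ : ∀ k, AEMeasurable (farWeight ω (c' k) (R' k)) := fun k =>
    (measurable_farWeight h.mono _ _).aemeasurable
  have hnR : ∀ j, (n / R j) ^ n * R j ^ n = (n:ℝ) ^ n := fun j => by
    have := (ha j).pos
    rw [div_pow]; field_simp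
  have i₁ : ∀ j, ∫⁻ x, F₁ j x ≤ I := fun j => by
    rw [hF₁]
    simp only [farWeight]
    rw [lintegral_mul_indicator (measurableSet_le_norm_sub _ _)]
    refine (lintegral_far_Rn (P j) (c j) (ha j).pos h.nonneg h.mono
      (hC₁ b hb hosc (c j) (R j) (ha j).pos).1).trans ?_
    rw [hI, add_assoc, add_assoc]
    exact le_self_add
  have i₂ : ∀ j, ∫⁻ x, F₂ j x ≤ I * ENNReal.ofReal α := fun j => by
    rw [hF₂]
    dsimp only
    rw [lintegral_mul_indicator_one_mul (hDm j)]
    refine (hC₂ K T h b hb hosc (a j) G (ha j).integrable iG hGs ((n / R j) ^ n) α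
      (by have := (ha j).pos; positivity) hα (ha j).bound hG (c j) (R j) (ha j).pos
      (ha j).eq_zero).trans ?_
    rw [mul_right_comm, hnR, ENNReal.ofReal_mul (by positivity), ← mul_assoc]
    gcongr
    rw [hI, add_assoc, add_assoc]
    exact le_add_left le_self_add
  have i₃ : ∀ j, ∫⁻ x, F₃ j x ≤ I := fun j => by
    rw [hF₃]
    dsimp only
    rw [lintegral_mul_indicator_one_mul (hDm j), lintegral_mul_const' _ _ ENNReal.ofReal_ne_top]
    refine (mul_le_mul_left (hC₁ b hb hosc (c j) (R j) (ha j).pos).2.1 _).trans ?_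
    rw [mul_assoc, ← ENNReal.ofReal_mul (by have := (ha j).pos; positivity), mul_comm (R j ^ n),
      hnR, hI, add_assoc]
    exact le_add_left le_self_add
  have i₄ : ∀ k, ∫⁻ x, farWeight ω (c' k) (R' k) x ≤ I := fun k =>
    (lintegral_farWeight_le (c' k) (ha' k).pos h.nonneg h.mono).trans (by
      rw [hI]; exact le_add_self)
  have hquad := volume_quadratic_le (F₁ := fun x => ∑ j, ENNReal.ofReal |lam j| * F₁ j x)
    (F₂ := fun x => ∑ j, ENNReal.ofReal |lam j| * F₂ j x)
    (F₃ := fun x => ∑ j, ENNReal.ofReal |lam j| * F₃ j x)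
    (F₄ := fun x => ∑ k, ENNReal.ofReal |μ k| * farWeight ω (c' k) (R' k) x)
    (Finset.aemeasurable_fun_sum _ fun j _ => (m₁ j).const_mul _)
    (Finset.aemeasurable_fun_sum _ fun j _ => (m₂ j).const_mul _)
    (Finset.aemeasurable_fun_sum _ fun j _ => (m₃ j).const_mul _)
    (Finset.aemeasurable_fun_sum _ fun j _ => (m₄ j).const_mul _) hα
    (lintegral_weighted_sum_le hlam m₁ i₁) (lintegral_weighted_sum_le hlam m₂ i₂)
    (lintegral_weighted_sum_le hlam m₃ i₃) (lintegral_weighted_sum_le hμ m₄ i₄) p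
  have hHL := hardyLittlewood_weak hn (fun y => ENNReal.ofReal |f y|)
    (ne_top_of_le_ne_top ENNReal.one_ne_top hf1) (a := ENNReal.ofReal α) (by simpa using hα)
    ENNReal.ofReal_ne_top
  set Ω : Set (Rn n) := {x | ∃ r : ℝ, 0 < r ∧ ENNReal.ofReal α * volume (closedBall x r) <
    ∫⁻ y in closedBall x r, ENNReal.ofReal |f y|} with hΩ
  set S : Set (Rn n) := {x | ENNReal.ofReal (α ^ 2 / 2) <
    p * ENNReal.ofReal α * (∑ j, ENNReal.ofReal |lam j| * F₁ j x) +
      (∑ j, ENNReal.ofReal |lam j| * F₂ j x) + p * ((∑ j, ENNReal.ofReal |lam j| * F₃ j x) *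
        ∑ k, ENNReal.ofReal |μ k| * farWeight ω (c' k) (R' k) x)} with hS
  have hΩv : volume Ω ≤ ENNReal.ofReal (5 ^ n) / ENNReal.ofReal α := by
    refine hHL.trans ?_
    rw [← mul_div_assoc]
    refine ENNReal.div_le_div_right ?_ _
    calc _ ≤ ENNReal.ofReal (5 ^ n) * 1 := by gcongr
      _ = _ := mul_one _
  have hpt : ∀ᵐ x, ∀ j, (∀ s, 0 < s → ∫⁻ y in closedBall x s, ENNReal.ofReal |f y| ≤
        ENNReal.ofReal α * volume (closedBall x s)) → (∀ k ∈ B, R' k ≤ ‖x - c' k‖) →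
      ENNReal.ofReal |T (a j) f x| ≤
        poissonConst n * ENNReal.ofReal α * farWeight ω (c j) (R j) x +
        (D j).indicator 1 x * ENNReal.ofReal |T (a j) G x| +
        poissonConst n * (((D j).indicator 1 x * ENNReal.ofReal ((n / R j) ^ n)) *
          ∑ k, ENNReal.ofReal |μ k| * farWeight ω (c' k) (R' k) x) :=
    ae_all_iff.2 fun j => h.atom_pointwise hn (ha j) ha' B μ hfi hfs iG hfG α
  calc _ ≤ volume (E ∪ (Ω ∪ S)) := by
        refine measure_mono_ae ?_
        filter_upwards [hpt] with x hx hmem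
        by_contra hcon
        have hxE : x ∉ E := fun hh => hcon (Or.inl hh)
        have hxΩ : x ∉ Ω := fun hh => hcon (Or.inr (Or.inl hh))
        refine hcon (Or.inr (Or.inr ?_))
        rw [hS, mem_ofPred_eq]
        refine ((ENNReal.ofReal_lt_ofReal_iff_of_nonneg (by positivity)).2 hmem).trans_le
          ((ofReal_abs_weighted_sum_le _ _ _).trans ?_)
        have hav : ∀ s, 0 < s → ∫⁻ y in closedBall x s, ENNReal.ofReal |f y| ≤
            ENNReal.ofReal α * volume (closedBall x s) := fun s hs => by
          by_contra! hlt
          exact hxΩ ⟨s, hs, hlt⟩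
        refine (Finset.sum_le_sum fun j _ => mul_le_mul_right (mul_le_mul_right
          (hx j hav fun k hk => hB k hk x hxE) _) _).trans_eq ?_
        rw [← hpe, Finset.mul_sum, Finset.sum_mul, Finset.mul_sum, ← Finset.sum_add_distrib,
          ← Finset.sum_add_distrib]
        refine Finset.sum_congr rfl fun j _ => ?_
        rw [hF₁, hF₂, hF₃]
        ring
    _ ≤ volume E + (volume Ω + volume S) :=
        (measure_union_le _ _).trans (add_le_add le_rfl (measure_union_le _ _))
    _ ≤ volume E + CC / ENNReal.ofReal α := by
        rw [hCC, ENNReal.add_div]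
        gcongr

/-- The weak-type bound for the commutator in the first entry. -/
theorem exists_commutator_const {n : ℕ} (hn : 1 ≤ n) (ω : ℝ → ℝ) {M : ℝ} (hM : 0 ≤ M)
    (hdini : diniSum ω ≠ ⊤) : ∃ C : ℝ≥0,
    ∀ (K : Rn n → Rn n → Rn n → ℝ) (T : (Rn n → ℝ) → (Rn n → ℝ) → Rn n → ℝ), NormCZ ω K T →
    ∀ b : Rn n → ℝ, LocallyIntegrable b volume → OscBound b M →
    ∀ f₁ f₂ : Rn n → ℝ, FiniteAtomicSum f₁ → FiniteAtomicSum f₂ → ∀ α : ℝ, 0 < α →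
      volume {x | α ^ 2 < |b x * T f₁ f₂ x - T (fun y => b y * f₁ y) f₂ x|} ≤
        C / ENNReal.ofReal α := by
  obtain ⟨C₁, hC₁⟩ := exists_bmo_const hn hM
  obtain ⟨C₂, hC₂⟩ := exists_main_const hn ω hM hdini
  set q : ℝ := (2 * (C₁ * (n:ℝ) ^ n)) ^ ((1:ℝ) / 2) with hq
  set CC : ℝ≥0∞ := splitConst n + C₂ + ENNReal.ofReal q with hCC
  have hCCt : CC ≠ ⊤ := by
    have := splitConst_ne_top n
    finiteness
  refine ⟨CC.toNNReal, ?_⟩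
  rw [ENNReal.coe_toNNReal hCCt]
  rintro K T h b hb hosc f₁ f₂ ⟨N, Q, a, lam, hQ, ha, hlam, hf₁⟩ ⟨N', Q', a', μ, hQ', ha', hμ, hf₂⟩
    α hα
  obtain rfl : f₁ = fun x => ∑ k, lam k * a k x := funext hf₁
  choose c R hR hsub hvol using fun j => (hQ j).exists_ball hn
  choose c' R' hR' hsub' hvol' using fun k => (hQ' k).exists_ball hn
  have hA : ∀ j, IsBallAtom (a j) (c j) (R j) := fun j =>
    (ha j).isBallAtom hn (hR j) (hsub j) (hvol j)
  have hA' : ∀ k, IsBallAtom (a' k) (c' k) (R' k) := fun k =>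
    (ha' k).isBallAtom hn (hR' k) (hsub' k) (hvol' k)
  obtain ⟨B, E, hE, hB, hG⟩ := exists_split hn hQ' ha' hμ hR' hsub' hvol' hα
  have hmain := hC₂ K T h b hb hosc (Fin N) (Fin N') lam a c R hlam hA μ a' c' R' hμ hA' f₂
    (funext hf₂) B E α hα hB hG
  have if₂ : Integrable f₂ := by
    rw [funext hf₂]; exact integrable_finsetSum _ fun k _ => (hA' k).integrable.const_mul _
  have nf₂ : l1norm f₂ ≤ 1 := by
    rw [funext hf₂]
    exact l1norm_weighted_sum_le hμ (fun k => (hA' k).integrable) (fun k => (hA' k).l1norm_le)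
      zero_le_one
  set β : Fin N → ℝ := fun j => ballMean b (c j) (R j) with hβ
  set w : Fin N → Rn n → ℝ := fun j y => (b y - β j) * a j y with hw
  have hwj : ∀ j, Integrable (w j) ∧ l1norm (w j) ≤ C₁ * (n:ℝ) ^ n := fun j =>
    (hA j).bmo_mul hn hb (hC₁ b hb hosc (c j) (R j) (hR j)).2.1
  set W : Rn n → ℝ := fun y => ∑ j, lam j * w j y with hW
  have iW : Integrable W := integrable_finsetSum _ fun j _ => (hwj j).1.const_mul _
  have nW : l1norm W ≤ C₁ * (n:ℝ) ^ n :=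
    l1norm_weighted_sum_le hlam (fun j => (hwj j).1) (fun j => (hwj j).2) (by positivity)
  have hweak : volume {x | α ^ 2 / 2 < |T W f₂ x|} ≤ ENNReal.ofReal q / ENNReal.ofReal α := by
    refine (h.weak W f₂ iW if₂ (α ^ 2 / 2) (by positivity)).trans ?_
    rw [← ENNReal.ofReal_div_of_pos hα]
    refine ENNReal.ofReal_le_ofReal ?_
    have hα' : α = (α ^ 2) ^ ((1:ℝ) / 2) := by
      rw [← Real.sqrt_eq_rpow, Real.sqrt_sq hα.le]
    have h0 : 0 ≤ l1norm f₂ := integral_nonneg fun _ => abs_nonneg _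
    have h1 : 0 ≤ l1norm W := integral_nonneg fun _ => abs_nonneg _
    calc (l1norm W * l1norm f₂ / (α ^ 2 / 2)) ^ ((1:ℝ) / 2)
        ≤ (2 * (C₁ * (n:ℝ) ^ n) / α ^ 2) ^ ((1:ℝ) / 2) := by
          refine Real.rpow_le_rpow (by positivity) ?_ (by norm_num)
          rw [div_div_eq_mul_div, mul_comm _ (2:ℝ)]
          refine div_le_div_of_nonneg_right (mul_le_mul_of_nonneg_left ?_ two_pos.le)
            (sq_nonneg α)
          exact (mul_le_mul nW nf₂ h0 (by positivity)).trans_eq (mul_one _)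
      _ = q / α := by
          rw [Real.div_rpow (by positivity) (by positivity), ← hα', hq]
  have hexp : ∀ x, b x * T (fun x => ∑ k, lam k * a k x) f₂ x -
      T (fun y => b y * ∑ k, lam k * a k y) f₂ x =
      (∑ j, lam j * ((b x - β j) * T (a j) f₂ x)) - T W f₂ x := by
    intro x
    have hsplit : (fun y => b y * ∑ k, lam k * a k y) =
        fun y => W y + ∑ j, (lam j * β j) * a j y := by
      funext y
      rw [hW, Finset.mul_sum, ← Finset.sum_add_distrib]
      refine Finset.sum_congr rfl fun j _ => ?_
      rw [hw]
      ring
    rw [hsplit, h.bilin.1 _ _ _ iW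
      (integrable_finsetSum _ fun j _ => (hA j).integrable.const_mul _) if₂,
      h.map_sum_left _ _ (fun j => (hA j).integrable) if₂,
      h.map_sum_left _ _ (fun j => (hA j).integrable) if₂, Finset.mul_sum, add_comm,
      ← sub_sub, ← Finset.sum_sub_distrib]
    congr 1
    exact Finset.sum_congr rfl fun j _ => by ring
  have hsub : {x | α ^ 2 < |b x * T (fun x => ∑ k, lam k * a k x) f₂ x -
      T (fun y => b y * ∑ k, lam k * a k y) f₂ x|} ⊆
      {x | α ^ 2 / 2 < |∑ j, lam j * ((b x - β j) * T (a j) f₂ x)|} ∪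
        {x | α ^ 2 / 2 < |T W f₂ x|} := by
    intro x hx
    by_contra hcon
    simp only [mem_union, mem_ofPred_eq, not_or, not_lt] at hcon hx
    rw [hexp] at hx
    have := abs_sub (∑ j, lam j * ((b x - β j) * T (a j) f₂ x)) (T W f₂ x)
    linarith [hcon.1, hcon.2]
  calc _ ≤ (volume E + C₂ / ENNReal.ofReal α) + ENNReal.ofReal q / ENNReal.ofReal α :=
        (measure_mono hsub).trans ((measure_union_le _ _).trans (add_le_add hmain hweak))
    _ ≤ (splitConst n / ENNReal.ofReal α + C₂ / ENNReal.ofReal α) +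
        ENNReal.ofReal q / ENNReal.ofReal α := by gcongr
    _ = CC / ENNReal.ofReal α := by rw [hCC, ENNReal.add_div, ENNReal.add_div]

/-- The extension of a modulus by zero to the nonpositive reals. -/
def posModulus (ω : ℝ → ℝ) (t : ℝ) : ℝ := if 0 < t then ω t else 0

lemma posModulus_nonneg {ω : ℝ → ℝ} (hω0 : ∀ t, 0 < t → 0 ≤ ω t) (t : ℝ) :
    0 ≤ posModulus ω t := by
  unfold posModulus
  split_ifs with h
  exacts [hω0 t h, le_rfl]

lemma monotone_posModulus {ω : ℝ → ℝ} (hω0 : ∀ t, 0 < t → 0 ≤ ω t)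
    (hωmono : ∀ s t : ℝ, 0 < s → s ≤ t → ω s ≤ ω t) : Monotone (posModulus ω) := by
  intro s t hst
  by_cases hs : 0 < s
  · rw [posModulus, posModulus, if_pos hs, if_pos (hs.trans_le hst)]
    exact hωmono s t hs hst
  · rw [posModulus, if_neg hs]
    exact posModulus_nonneg hω0 t

lemma diniSum_posModulus (ω : ℝ → ℝ) : diniSum (posModulus ω) = diniSum ω := by
  unfold diniSum
  refine tsum_congr fun i => ?_
  rw [posModulus, if_pos (by positivity)]

lemma div_mul_le_posModulus {ω : ℝ → ℝ} {C₀ D s d u v : ℝ} (hC₀ : 0 ≤ C₀) (hD : C₀ ≤ D)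
    (hω0 : ∀ t, 0 < t → 0 ≤ ω t) (hs : 0 ≤ s) (hu : |u - v| ≤ C₀ / s * ω d) (hd0 : 0 ≤ d)
    (hd : d = 0 → u = v) : |u / D - v / D| ≤ 1 / s * posModulus ω d := by
  rcases hd0.eq_or_lt with h0 | h0
  · rw [hd h0.symm, sub_self, abs_zero]
    exact mul_nonneg (by positivity) (posModulus_nonneg hω0 d)
  · rw [posModulus, if_pos h0, ← sub_div, abs_div]
    have hD0 : 0 ≤ D := hC₀.trans hD
    rw [abs_of_nonneg hD0]
    refine div_le_of_le_mul₀ hD0 (mul_nonneg (by positivity) (hω0 d h0)) (hu.trans ?_)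
    have := hω0 d h0
    rw [show C₀ / s * ω d = 1 / s * ω d * C₀ by ring]
    gcongr

/-- Normalizing a bilinear Calderón–Zygmund operator. -/
lemma NormCZ.of_div {n : ℕ} {ω : ℝ → ℝ} (hω0 : ∀ t, 0 < t → 0 ≤ ω t)
    (hωmono : ∀ s t : ℝ, 0 < s → s ≤ t → ω s ≤ ω t) (hdini : diniSum ω ≠ ⊤) {C₀ C₂ D : ℝ}
    {K : Rn n → Rn n → Rn n → ℝ} {T : (Rn n → ℝ) → (Rn n → ℝ) → Rn n → ℝ} (hC₀ : 0 < C₀)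
    (hC₂ : 0 ≤ C₂) (hD₀ : C₀ ≤ D) (hD₂ : C₂ ≤ D) (hK : IsCZKernel2 C₀ ω K)
    (hmeas : ∀ f g : Rn n → ℝ, Integrable f → Integrable g → Measurable (T f g))
    (hbil : Bilin2 T) (hrep : KernelRep2 K T)
    (hweak : ∀ f g : Rn n → ℝ, Integrable f → Integrable g → ∀ lam : ℝ, 0 < lam →
      volume {x | lam < |T f g x|} ≤
        ENNReal.ofReal ((C₂ * l1norm f * l1norm g / lam) ^ ((1:ℝ)/2))) :
    NormCZ (posModulus ω) (fun x y₁ y₂ => K x y₁ y₂ / D) (fun f g x => T f g x / D) where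
  nonneg := posModulus_nonneg hω0
  mono := monotone_posModulus hω0 hωmono
  dini := by rwa [diniSum_posModulus]
  kernel := by
    have hD : 0 < D := hC₀.trans_le hD₀
    obtain ⟨h1, h2, h3, h4⟩ := hK
    have hzero : ∀ {x y₁ y₂ z z' : Rn n}, ¬(x = y₁ ∧ y₁ = y₂) →
        ‖z - z'‖ / (‖x - y₁‖ + ‖x - y₂‖) = 0 → z = z' := by
      intro x y₁ y₂ z z' hne h0
      rcases div_eq_zero_iff.1 h0 with h | h
      · exact sub_eq_zero.1 (norm_eq_zero.1 h)
      · obtain ⟨e1, e2⟩ := (add_eq_zero_iff_of_nonneg (norm_nonneg _) (norm_nonneg _)).1 h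
        have e1 := sub_eq_zero.1 (norm_eq_zero.1 e1)
        have e2 := sub_eq_zero.1 (norm_eq_zero.1 e2)
        exact absurd ⟨e1, e1.symm.trans e2⟩ hne
    refine ⟨fun x y₁ y₂ hd => ?_, fun x x' y₁ y₂ hd hx => ?_, fun x y₁ y₁' y₂ hd hx => ?_,
      fun x y₁ y₂ y₂' hd hx => ?_⟩
    · rw [abs_div, abs_of_pos hD, div_le_iff₀ hD, one_div_mul_eq_div]
      exact (h1 x y₁ y₂ hd).trans (by gcongr)
    · exact div_mul_le_posModulus hC₀.le hD₀ hω0 (by positivity) (h2 x x' y₁ y₂ hd hx)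
        (by positivity) fun h0 => by rw [hzero hd h0]
    · exact div_mul_le_posModulus hC₀.le hD₀ hω0 (by positivity) (h3 x y₁ y₁' y₂ hd hx)
        (by positivity) fun h0 => by rw [hzero hd h0]
    · exact div_mul_le_posModulus hC₀.le hD₀ hω0 (by positivity) (h4 x y₁ y₂ y₂' hd hx)
        (by positivity) fun h0 => by rw [hzero hd h0]
  meas := fun f g hf hg => (hmeas f g hf hg).div_const D
  bilin := by
    obtain ⟨h1, h2, h3, h4⟩ := hbil
    refine ⟨fun f f' g hf hf' hg x => ?_, fun r f g hf hg x => ?_,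
      fun f g g' hf hg hg' x => ?_, fun r f g hf hg x => ?_⟩
    · beta_reduce; rw [h1 f f' g hf hf' hg, add_div]
    · beta_reduce; rw [h2 r f g hf hg, mul_div_assoc]
    · beta_reduce; rw [h3 f g g' hf hg hg', add_div]
    · beta_reduce; rw [h4 r f g hf hg, mul_div_assoc]
  rep := fun f g hf hg hfs hgs => by
    filter_upwards [hrep f g hf hg hfs hgs] with x hx hmem
    rw [hx hmem, ← integral_div]
    exact integral_congr_ae (ae_of_all _ fun y => by ring)
  weak := fun f g hf hg lam hlam => by
    have hD : 0 < D := hC₀.trans_le hD₀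
    have hset : {x | lam < |T f g x / D|} = {x | lam * D < |T f g x|} := by
      ext x
      rw [mem_ofPred_eq, mem_ofPred_eq, abs_div, abs_of_pos hD, lt_div_iff₀ hD]
    have h0 : 0 ≤ l1norm f := integral_nonneg fun _ => abs_nonneg _
    have h1 : 0 ≤ l1norm g := integral_nonneg fun _ => abs_nonneg _
    rw [hset]
    refine (hweak f g hf hg (lam * D) (by positivity)).trans (ENNReal.ofReal_le_ofReal ?_)
    refine Real.rpow_le_rpow (by positivity) ?_ (by norm_num)
    rw [div_le_div_iff₀ (by positivity) hlam]
    calc C₂ * l1norm f * l1norm g * lam ≤ D * l1norm f * l1norm g * lam := by gcongr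
      _ = _ := by ring

/-- The full commutator
`T_{b⃗}(f₁,f₂) = [b₁·T(f₁,f₂) − T(b₁f₁,f₂)] + [b₂·T(f₁,f₂) − T(f₁,b₂f₂)]`
of a bilinear Calderón–Zygmund operator of `ω` type, with `ω` non-decreasing satisfying the
log-Dini(1) condition and `b₁, b₂ ∈ BMO`, maps pairs of finite atomic sums into weak
`L^{1/2}`, with constant `C·(C₀+C₁+C₂)^{1/2}` depending only on `n`, `ω` and the BMO bounds. -/
theorem stmt1 (n : ℕ) (hn : 1 ≤ n) (ω : ℝ → ℝ)
    (hω0 : ∀ t, 0 < t → 0 ≤ ω t)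
    (hωmono : ∀ s t : ℝ, 0 < s → s ≤ t → ω s ≤ ω t)
    (hω_logDini : IntegrableOn (fun t => ω t * (1 + Real.log (1 / t)) / t) (Ioo (0:ℝ) 1))
    (M₁ M₂ : ℝ) (hM₁ : 0 ≤ M₁) (hM₂ : 0 ≤ M₂) :
    ∃ C : ℝ, 0 < C ∧
      ∀ (C₀ C₁ C₂ : ℝ) (K : Rn n → Rn n → Rn n → ℝ)
        (T : (Rn n → ℝ) → (Rn n → ℝ) → Rn n → ℝ) (b₁ b₂ : Rn n → ℝ),
        0 < C₀ → 0 < C₁ → 0 < C₂ →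
        IsCZKernel2 C₀ ω K →
        (∀ f g : Rn n → ℝ, Integrable f → Integrable g → Measurable (T f g)) →
        Bilin2 T →
        KernelRep2 K T →
        LocallyIntegrable b₁ volume → OscBound b₁ M₁ →
        LocallyIntegrable b₂ volume → OscBound b₂ M₂ →
        -- weak `L²×L² → L^{1,∞}` bound for the commutator `T_{b⃗}`
        (∀ f g : Rn n → ℝ, Measurable f → Measurable g →
          (∃ A : ℝ, ∀ x, |f x| ≤ A) → (∃ A : ℝ, ∀ x, |g x| ≤ A) →
          HasCompactSupport f → HasCompactSupport g →
          ∀ lam : ℝ, 0 < lam →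
            volume {x | lam <
                |(b₁ x * T f g x - T (fun y => b₁ y * f y) g x) +
                  (b₂ x * T f g x - T f (fun y => b₂ y * g y) x)|} ≤
              ENNReal.ofReal (C₁ * l2norm f * l2norm g / lam)) →
        -- weak `L¹×L¹ → L^{1/2,∞}` bound for `T`
        (∀ f g : Rn n → ℝ, Integrable f → Integrable g → ∀ lam : ℝ, 0 < lam →
            volume {x | lam < |T f g x|} ≤
              ENNReal.ofReal ((C₂ * l1norm f * l1norm g / lam) ^ ((1:ℝ)/2))) →
        ∀ f₁ f₂ : Rn n → ℝ, FiniteAtomicSum f₁ → FiniteAtomicSum f₂ →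
        ∀ lam : ℝ, 0 < lam →
          volume {x | lam <
              |(b₁ x * T f₁ f₂ x - T (fun y => b₁ y * f₁ y) f₂ x) +
                (b₂ x * T f₁ f₂ x - T f₁ (fun y => b₂ y * f₂ y) x)|} ≤
            ENNReal.ofReal (C * (C₀ + C₁ + C₂) ^ ((1:ℝ)/2) * lam ^ (-(1:ℝ)/2)) := by
  have hdini : diniSum (posModulus ω) ≠ ⊤ := by
    rw [diniSum_posModulus]; exact diniSum_ne_top hω0 hωmono hω_logDini
  obtain ⟨A₁, hA₁⟩ := exists_commutator_const hn (posModulus ω) hM₁ hdini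
  obtain ⟨A₂, hA₂⟩ := exists_commutator_const hn (posModulus ω) hM₂ hdini
  refine ⟨(A₁ + A₂ + 1) * 2 ^ ((1:ℝ) / 2), by positivity, ?_⟩
  intro C₀ C₁ C₂ K T b₁ b₂ hC₀ hC₁ hC₂ hK hmeas hbil hrep hb₁ hosc₁ hb₂ hosc₂ _ hweak
    f₁ f₂ hf₁ hf₂ lam hlam
  set D := C₀ + C₁ + C₂ with hD
  have hD0 : 0 < D := by positivity
  have h : NormCZ (posModulus ω) (fun x y₁ y₂ => K x y₁ y₂ / D) (fun f g x => T f g x / D) :=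
    NormCZ.of_div hω0 hωmono (diniSum_ne_top hω0 hωmono hω_logDini) hC₀ hC₂.le
      (by rw [hD]; linarith) (by rw [hD]; linarith) hK hmeas hbil hrep hweak
  set α : ℝ := (lam / (2 * D)) ^ ((1:ℝ) / 2) with hα
  have hα0 : 0 < α := by positivity
  have hα2 : α ^ 2 = lam / (2 * D) := by
    rw [hα, ← Real.sqrt_eq_rpow, Real.sq_sqrt (by positivity)]
  have v₁ := hA₁ _ _ h b₁ hb₁ hosc₁ f₁ f₂ hf₁ hf₂ α hα0
  have v₂ := hA₂ _ _ h.swap b₂ hb₂ hosc₂ f₂ f₁ hf₂ hf₁ α hα0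
  rw [hα2] at v₁ v₂
  have hscale : ∀ u v w : ℝ, lam / 2 < |u * v - w| → lam / (2 * D) < |u * (v / D) - w / D| := by
    intro u v w huv
    rw [← mul_div_assoc, ← sub_div, abs_div, abs_of_pos hD0, ← div_div]
    gcongr
  have hsub : {x | lam < |(b₁ x * T f₁ f₂ x - T (fun y => b₁ y * f₁ y) f₂ x) +
      (b₂ x * T f₁ f₂ x - T f₁ (fun y => b₂ y * f₂ y) x)|} ⊆
      {x | lam / (2 * D) < |b₁ x * (T f₁ f₂ x / D) - T (fun y => b₁ y * f₁ y) f₂ x / D|} ∪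
        {x | lam / (2 * D) < |b₂ x * (T f₁ f₂ x / D) - T f₁ (fun y => b₂ y * f₂ y) x / D|} := by
    intro x hx
    rw [mem_ofPred_eq] at hx
    by_contra hcon
    simp only [mem_union, mem_ofPred_eq, not_or] at hcon
    have q₁ := not_lt.1 fun hlt => hcon.1 (hscale _ _ _ hlt)
    have q₂ := not_lt.1 fun hlt => hcon.2 (hscale _ _ _ hlt)
    linarith [abs_add_le (b₁ x * T f₁ f₂ x - T (fun y => b₁ y * f₁ y) f₂ x)
      (b₂ x * T f₁ f₂ x - T f₁ (fun y => b₂ y * f₂ y) x)]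
  calc _ ≤ A₁ / ENNReal.ofReal α + A₂ / ENNReal.ofReal α :=
        (measure_mono hsub).trans ((measure_union_le _ _).trans (add_le_add v₁ v₂))
    _ = ENNReal.ofReal ((A₁ + A₂) / α) := by
        rw [ENNReal.ofReal_div_of_pos hα0, ENNReal.ofReal_add A₁.coe_nonneg A₂.coe_nonneg, ENNReal.add_div,
          ENNReal.ofReal_coe_nnreal, ENNReal.ofReal_coe_nnreal]
    _ ≤ _ := by
        refine ENNReal.ofReal_le_ofReal ?_
        have hαi : α⁻¹ = 2 ^ ((1:ℝ) / 2) * D ^ ((1:ℝ) / 2) * lam ^ (-(1:ℝ) / 2) := by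
          rw [hα, ← Real.inv_rpow (by positivity), inv_div,
            Real.div_rpow (by positivity) hlam.le, Real.mul_rpow (by norm_num) hD0.le, neg_div,
            Real.rpow_neg hlam.le, div_eq_mul_inv]
        rw [div_eq_mul_inv, hαi]
        calc (A₁ + A₂ : ℝ) * (2 ^ ((1:ℝ) / 2) * D ^ ((1:ℝ) / 2) * lam ^ (-(1:ℝ) / 2))
            ≤ (A₁ + A₂ + 1 : ℝ) * (2 ^ ((1:ℝ) / 2) * D ^ ((1:ℝ) / 2) * lam ^ (-(1:ℝ) / 2)) := by
              exact mul_le_mul_of_nonneg_right (by linarith) (by positivity)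
          _ = _ := by ring
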